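/- arXiv:1908.03865 — 6 statements merged into one kernel-verified Lean document; each statement's English description precedes it below -/
import Mathlib

section
/- The Valknut linking of three triangles is not combinatorially isotopic (for any ordering of the triangles) to any linking of three triangles whose convex hulls are pairwise disjoint. -/
open scoped Matrix

noncomputable section

/-- A point of 3-space. -/
abbrev Pt : Type := Fin 3 → ℝ

/-- A (non-degenerate) triangle in 3-space, given by three affinely independent vertices. -/
structure Tri where
  A : Pt
  B : Pt
  C : Pt
  indep : AffineIndependent ℝ ![A, B, C]

namespace Tri

/-- The set of vertices of a triangle. -/
def vertexSet (T : Tri) : Set Pt := {T.A, T.B, T.C}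

/-- The outline `∂T` of a triangle: the union of the three closed edges. -/
def outline (T : Tri) : Set Pt :=
  segment ℝ T.A T.B ∪ segment ℝ T.B T.C ∪ segment ℝ T.C T.A

/-- The convex hull `⟨T⟩` of a triangle. -/
def hull (T : Tri) : Set Pt := convexHull ℝ {T.A, T.B, T.C}

end Tri

/-- A family of triangles is a linking if the outlines are pairwise disjoint. -/
def IsLinking {ι : Type*} (T : ι → Tri) : Prop :=
  ∀ i j, i ≠ j → Disjoint (T i).outline (T j).outline

/-- An elementary move replaces one triangle `ABC` of the family by `ABC'`, where `C'` is a
point not on the line `AB` such that `(⟨A,C,C'⟩ ∪ ⟨B,C,C'⟩) ∩ ∂XYZ = ∅` for every other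
triangle `XYZ` of the family. -/
def ElemMove {ι : Type*} (T T' : ι → Tri) : Prop :=
  ∃ (i : ι) (A B C C' : Pt),
    (T i).vertexSet = {A, B, C} ∧
    (T' i).vertexSet = {A, B, C'} ∧
    C' ∉ affineSpan ℝ ({A, B} : Set Pt) ∧
    ∀ j, j ≠ i →
      (convexHull ℝ ({A, C, C'} : Set Pt) ∪ convexHull ℝ ({B, C, C'} : Set Pt))
          ∩ (T j).outline = ∅ ∧
      T' j = T j

/-- Two families of triangles are combinatorially isotopic if one can be obtained from the
other by a finite sequence of elementary moves. -/
def CombIsotopic {ι : Type*} (T T' : ι → Tri) : Prop :=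
  Relation.ReflTransGen ElemMove T T'

/-- The cyclic coordinate permutation `σ(a,b,c) = (c,a,b)`. -/
def cyc (v : Pt) : Pt := ![v 2, v 0, v 1]

def w₁ : Pt := ![1, 0, 0]
def w₂ : Pt := ![-2 / Real.sqrt 5, 1 / Real.sqrt 10, 0]
def w₃ : Pt := ![-2 / Real.sqrt 5, -1 / Real.sqrt 10, 0]

/-- `T` is the Valknut linking: the first triangle has vertices `(1,0,0)`,
`(-2/√5, ±1/√10, 0)`, and each subsequent triangle is the image of the previous one under
the cyclic coordinate permutation. -/
def IsValknut (T : Fin 3 → Tri) : Prop :=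
  (T 0).vertexSet = {w₁, w₂, w₃} ∧
  (T 1).vertexSet = {cyc w₁, cyc w₂, cyc w₃} ∧
  (T 2).vertexSet = {cyc (cyc w₁), cyc (cyc w₂), cyc (cyc w₃)}


def tau (a b p q : ℝ) : ℝ := max (-a-p) ((1+a)*|q| - b*(1-p))

lemma tau_cont (a b : ℝ) : Continuous fun z : ℝ × ℝ => tau a b z.1 z.2 := by
  unfold tau; fun_prop

lemma tau_zero {a b p q : ℝ} (ha : 0 < a) (hb : 0 < b) (h : tau a b p q = 0) :
    ∃ α β γ : ℝ, 0 ≤ α ∧ 0 ≤ β ∧ 0 ≤ γ ∧ α + β + γ = 1 ∧ (α = 0 ∨ β = 0 ∨ γ = 0) ∧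
      p = α - a * (β + γ) ∧ q = b * (β - γ) := by
  unfold tau at h
  have h1 : -a - p ≤ 0 := h ▸ le_max_left _ _
  have h2 : (1+a)*|q| - b*(1-p) ≤ 0 := h ▸ le_max_right _ _
  have hk : 0 < 1 + a := by linarith
  rcases max_choice (-a-p) ((1+a)*|q| - b*(1-p)) with h3 | h3
  · rw [h] at h3
    have hp : p = -a := by linarith
    subst hp
    have h4 : |q| ≤ b := by
      have : (1+a)*|q| ≤ (1+a) * b := by linarith
      exact le_of_mul_le_mul_left this hk
    have h5 := abs_le.1 h4
    refine ⟨0, (b+q)/(2*b), (b-q)/(2*b), le_rfl, ?_, ?_, ?_, Or.inl rfl, ?_, ?_⟩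
    · apply div_nonneg <;> linarith
    · apply div_nonneg <;> linarith
    · field_simp; ring
    · field_simp; ring
    · field_simp; ring
  · rw [h] at h3
    have h6 : |q| = b * (1-p) / (1+a) := by field_simp; linarith
    have h7 : 0 ≤ (p+a)/(1+a) := by apply div_nonneg <;> linarith
    have h8 : |q| / b = (1-p)/(1+a) := by rw [h6]; field_simp
    rcases le_total 0 q with hq | hq
    · rw [abs_of_nonneg hq] at h8
      refine ⟨(p+a)/(1+a), q/b, 0, h7, by positivity, le_rfl, ?_, by simp, ?_, ?_⟩
      · rw [h8]; field_simp; ring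
      · rw [h8]; field_simp; ring
      · field_simp; ring
    · rw [abs_of_nonpos hq] at h8
      refine ⟨(p+a)/(1+a), 0, -q/b, h7, le_rfl, ?_, ?_, by simp, ?_, ?_⟩
      · apply div_nonneg <;> linarith
      · rw [h8]; field_simp; ring
      · rw [h8]; field_simp; ring
      · field_simp; ring

/-- outline of three points -/
def outl (A B C : Pt) : Set Pt := segment ℝ A B ∪ segment ℝ B C ∪ segment ℝ C A

lemma mem_outl {A B C : Pt} {α β γ : ℝ} (hα : 0 ≤ α) (hβ : 0 ≤ β) (hγ : 0 ≤ γ)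
    (hs : α + β + γ = 1) (h : α = 0 ∨ β = 0 ∨ γ = 0) :
    α • A + β • B + γ • C ∈ outl A B C := by
  rcases h with h | h | h <;> subst h
  · left; right; exact ⟨β, γ, hβ, hγ, by linarith, by simp⟩
  · right; exact ⟨γ, α, hγ, hα, by linarith, by simp [add_comm]⟩
  · left; left; exact ⟨α, β, hα, hβ, by linarith, by simp⟩

lemma sgn_const {g : Pt → ℝ} (hg : Continuous g) {X Y : Pt}
    (h : ∀ x ∈ segment ℝ X Y, g x ≠ 0) (hX : 0 < g X) : ∀ x ∈ segment ℝ X Y, 0 < g x := by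
  intro x hx
  by_contra hn
  have hp : IsPreconnected (segment ℝ X Y) := (convex_segment X Y).isPreconnected
  obtain ⟨z, hz, hz0⟩ := hp.intermediate_value hx (left_mem_segment ℝ X Y) hg.continuousOn
    ⟨not_lt.1 hn, hX.le⟩
  exact h z hz hz0

lemma exists_sqrt (g : Pt → ℂ) (hg : Continuous g) (h0 : ∀ x, g x ≠ 0) :
    ∃ r : Pt → ℂ, Continuous r ∧ ∀ x, r x ^ 2 = g x := by
  have hs : IsSimplyConnected (Set.univ : Set Pt) := by
    have : ContractibleSpace (Set.univ : Set Pt) :=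
      (Homeomorph.Set.univ Pt).contractibleSpace
    exact SimplyConnectedSpace.ofContractible _
  obtain ⟨r, hr, h⟩ := Complex.exists_continuousOn_pow_eq hs isOpen_univ hg.continuousOn
    (by simpa using h0) (n := 2) two_ne_zero
  exact ⟨r, continuousOn_univ.1 hr, h⟩

def rho (u v : ℝ) : ℂ := if 0 ≤ v then (⟨u, v⟩ : ℂ)^2 else ((u^2+v^2 : ℝ) : ℂ)

lemma rho_neg {u v : ℝ} (h : v ≤ 0) : rho u v = ((u^2+v^2 : ℝ) : ℂ) := by
  unfold rho
  split_ifs with h'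
  · have : v = 0 := le_antisymm h h'
    subst this
    apply Complex.ext <;> simp [pow_two]
  · rfl

lemma mk_cont {X : Type*} [TopologicalSpace X] {u v : X → ℝ} (hu : Continuous u)
    (hv : Continuous v) : Continuous fun x => (⟨u x, v x⟩ : ℂ) := by
  have : (fun x => (⟨u x, v x⟩ : ℂ)) = fun x => (u x : ℂ) + (v x : ℂ) * Complex.I := by
    ext x; apply Complex.ext <;> simp
  rw [this]; fun_prop

lemma rho_cont : Continuous fun z : ℝ × ℝ => rho z.1 z.2 := by
  unfold rho
  apply Continuous.if_le
  · exact (mk_cont continuous_fst continuous_snd).pow 2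
  · fun_prop
  · fun_prop
  · fun_prop
  · intro z hz
    rw [← hz]
    apply Complex.ext <;> simp [pow_two]

lemma rho_ne {u v : ℝ} (h : ¬ (u = 0 ∧ v = 0)) : rho u v ≠ 0 := by
  unfold rho
  split_ifs with h'
  · intro h0
    rw [pow_eq_zero_iff two_ne_zero, Complex.ext_iff] at h0
    exact h h0
  · intro h0
    have h0 : u^2+v^2 = 0 := by exact_mod_cast h0
    exact h ⟨by nlinarith [sq_nonneg u, sq_nonneg v], by nlinarith [sq_nonneg u, sq_nonneg v]⟩

lemma sq_ne {u v : ℝ} (h : ¬ (u = 0 ∧ v = 0)) : 0 < u^2+v^2 := by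
  by_contra h0
  exact h ⟨by nlinarith [sq_nonneg u, sq_nonneg v], by nlinarith [sq_nonneg u, sq_nonneg v]⟩

lemma re_ne_of_sq {r : ℂ} {s : ℝ} (hs : 0 < s) (h : r^2 = (s : ℂ)) : r.re ≠ 0 := by
  intro h0
  have := congrArg Complex.re h
  simp [pow_two, h0] at this
  nlinarith [mul_self_nonneg r.im]

set_option maxHeartbeats 4000000 in
/-- the topological core -/
lemma no_disc (a b : ℝ) (ha2 : a^2 = 4/5) (hb2 : b^2 = 1/10) (ha : 0 < a) (hb : 0 < b)
    (f : Pt → Pt) (hf : Continuous f)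
    (hid : ∀ x ∈ outl ![1,0,0] ![-a,b,0] ![-a,-b,0], f x = x)
    (h1 : ∀ x, f x ∉ outl ![0,1,0] ![0,-a,b] ![0,-a,-b])
    (h2 : ∀ x, f x ∉ outl ![0,0,1] ![b,0,-a] ![-b,0,-a]) : False := by
  have a1 : 0.89 < a := by nlinarith
  have a2 : a < 0.9 := by nlinarith
  have b1 : 0.31 < b := by nlinarith
  have b2 : b < 0.32 := by nlinarith
  -- first square root
  let t1 : Pt → ℝ := fun x => tau a b (f x 1) (f x 2)
  have ht1 : Continuous t1 := (tau_cont a b).comp (by fun_prop : Continuous fun x => (f x 1, f x 2))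
  let u : Pt → ℝ := fun x => tau a b (f x 2) (f x 0)
  have hu : Continuous u := (tau_cont a b).comp (by fun_prop : Continuous fun x => (f x 2, f x 0))
  let v : Pt → ℝ := fun x => f x 1 + 5 * min 0 (u x)
  have hv : Continuous v := by fun_prop
  have n1 : ∀ x, ¬ (t1 x = 0 ∧ f x 0 = 0) := by
    rintro x ⟨h, h'⟩
    obtain ⟨α, β, γ, hα, hβ, hγ, hs, hz, e1, e2⟩ := tau_zero ha hb h
    apply h1 x
    convert mem_outl (A := ![0,1,0]) (B := ![0,-a,b]) (C := ![0,-a,-b]) hα hβ hγ hs hz using 1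
    ext i; fin_cases i
    · simpa using h'
    · simp [e1]; ring
    · simp [e2]; ring
  have n2 : ∀ x, ¬ (u x = 0 ∧ v x = 0) := by
    rintro x ⟨h, h'⟩
    have h' : f x 1 = 0 := by simpa [v, h] using h'
    obtain ⟨α, β, γ, hα, hβ, hγ, hs, hz, e1, e2⟩ := tau_zero ha hb h
    apply h2 x
    convert mem_outl (A := ![0,0,1]) (B := ![b,0,-a]) (C := ![-b,0,-a]) hα hβ hγ hs hz using 1
    ext i; fin_cases i
    · simp [e2]; ring
    · simpa using h'
    · simp [e1]; ring
  obtain ⟨r₀, hr₀, hr₀2⟩ := exists_sqrt (fun x => ⟨t1 x, f x 0⟩) (mk_cont ht1 (by fun_prop))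
    (by intro x h; rw [Complex.ext_iff] at h; exact n1 x h)
  -- boundary facts
  have bd : ∀ x ∈ outl ![1,0,0] ![-a,b,0] ![-a,-b,0], x 2 = 0 ∧ -a ≤ x 0 ∧ x 0 ≤ 1 ∧
      -b ≤ x 1 ∧ x 1 ≤ b := by
    rintro x ((⟨α, β, hα, hβ, hs, rfl⟩ | ⟨α, β, hα, hβ, hs, rfl⟩) | ⟨α, β, hα, hβ, hs, rfl⟩) <;>
    · obtain rfl : β = 1 - α := by linarith
      simp
      refine ⟨?_, ?_, ?_, ?_⟩ <;> nlinarith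
  let D : Set Pt := outl ![1,0,0] ![-a,b,0] ![-a,-b,0]
  have D1 : segment ℝ ![1,0,0] ![-a,b,0] ⊆ D := fun x hx => Or.inl (Or.inl hx)
  have D2 : segment ℝ ![-a,b,0] ![-a,-b,0] ⊆ D := fun x hx => Or.inl (Or.inr hx)
  have D3 : segment ℝ ![1,0,0] ![-a,-b,0] ⊆ D := fun x hx => Or.inr (by rwa [segment_symm])
  have im0 : ∀ x ∈ D, (r₀ x).im ≠ 0 := by
    intro x hx h0
    have e := hr₀2 x
    have e1 := congrArg Complex.re e
    have e2 := congrArg Complex.im e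
    simp [pow_two, h0] at e1 e2
    simp only [t1] at e1
    rw [hid x hx] at e1 e2
    obtain ⟨b0, b1', b2', b3, b4⟩ := bd x hx
    have : tau a b (x 1) (x 2) < 0 := by
      unfold tau; rw [b0]; simp
      constructor <;> nlinarith
    nlinarith [mul_self_nonneg (r₀ x).re]
  obtain ⟨r, hr, hr2, hrp⟩ : ∃ r : Pt → ℂ, Continuous r ∧ (∀ x, r x ^ 2 = ⟨t1 x, f x 0⟩) ∧
      0 < (r ![1,0,0]).im := by
    rcases lt_or_gt_of_ne (im0 ![1,0,0] (D1 (left_mem_segment ℝ _ _))) with h | h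
    · exact ⟨fun x => - r₀ x, hr₀.neg, by simpa using hr₀2, by simpa using h⟩
    · exact ⟨r₀, hr₀, hr₀2, h⟩
  have imr : ∀ x ∈ D, (r x).im ≠ 0 := by
    intro x hx h0
    apply im0 x hx
    have e : (r x - r₀ x) * (r x + r₀ x) = 0 := by
      linear_combination hr2 x - hr₀2 x
    rcases mul_eq_zero.1 e with e | e
    · have := congrArg Complex.im e; simp [h0] at this; exact this
    · have := congrArg Complex.im e; simp [h0] at this; exact this
  have imc : Continuous fun x => (r x).im := Complex.continuous_im.comp hr
  have im1 := sgn_const imc (fun x hx => imr x (D1 hx)) hrp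
  have im3 := sgn_const imc (fun x hx => imr x (D3 hx)) hrp
  have im2 := sgn_const imc (fun x hx => imr x (D2 hx)) (im1 _ (right_mem_segment ℝ _ _))
  have imp : ∀ x ∈ D, 0 < (r x).im := by
    rintro x ((h | h) | h)
    · exact im1 x h
    · exact im2 x h
    · exact im3 x (by rwa [segment_symm])
  have rex : ∀ x ∈ D, 2 * (r x).re * (r x).im = x 0 := by
    intro x hx
    have e2 := congrArg Complex.im (hr2 x)
    simp [pow_two] at e2
    rw [hid x hx] at e2
    linarith
  -- second function
  let Q : Pt → ℂ := fun x => if 0 ≤ (r x).re then rho (u x) (v x) else (((u x)^2+(v x)^2 : ℝ) : ℂ)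
  have hQ : Continuous Q := by
    apply Continuous.if_le
    · exact rho_cont.comp (hu.prodMk hv)
    · fun_prop
    · fun_prop
    · exact Complex.continuous_re.comp hr
    · intro x hx
      apply rho_neg
      have e := hr2 x
      have e1 := congrArg Complex.re e
      have e2 := congrArg Complex.im e
      simp [pow_two, ← hx] at e1 e2
      have t0 : t1 x < 0 := by
        rcases lt_or_eq_of_le (show t1 x ≤ 0 by nlinarith [mul_self_nonneg (r x).im]) with h | h
        · exact h
        · exact absurd ⟨h, e2.symm⟩ (n1 x)
      simp only [t1, tau] at t0
      rw [max_lt_iff] at t0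
      have z0 : |f x 2| < b := by
        have : (1+a) * |f x 2| < (1+a) * b := by nlinarith
        exact lt_of_mul_lt_mul_left this (by linarith)
      obtain ⟨z1, z2⟩ := abs_lt.1 z0
      have y1 : f x 1 < 1 := by
        have : 0 ≤ (1+a) * |f x 2| := by positivity
        nlinarith
      have : u x ≤ -0.2 := by
        simp only [u, tau, ← e2]
        apply max_le
        · linarith
        · simp; nlinarith
      have : min 0 (u x) ≤ -0.2 := (min_le_right _ _).trans this
      simp only [v]; linarith
  have hQ0 : ∀ x, Q x ≠ 0 := by
    intro x
    simp only [Q]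
    split_ifs
    · exact rho_ne (n2 x)
    · exact_mod_cast (sq_ne (n2 x)).ne'
  obtain ⟨s, hs, hs2⟩ := exists_sqrt Q hQ hQ0
  have src : Continuous fun x => (s x).re := Complex.continuous_re.comp hs
  have Qpos : ∀ x, ((r x).re < 0 ∨ v x ≤ 0) → (s x).re ≠ 0 := by
    intro x hx
    apply re_ne_of_sq (sq_ne (n2 x))
    rw [hs2]
    simp only [Q]
    split_ifs with h
    · rcases hx with hx | hx
      · linarith
      · exact rho_neg hx
    · rfl
  have ub : ∀ x ∈ D, u x = (1+a) * |x 0| - b := by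
    intro x hx
    obtain ⟨b0, b1', b2', b3, b4⟩ := bd x hx
    simp only [u, tau]
    rw [hid x hx, b0, max_eq_right]
    · ring
    · have : 0 ≤ (1+a) * |x 0| := by positivity
      linarith
  have vle : ∀ x ∈ D, v x ≤ x 1 := by
    intro x hx
    simp only [v, hid x hx]
    have := min_le_left 0 (u x)
    linarith
  have rneg : ∀ x ∈ D, x 0 < 0 → (r x).re < 0 := by
    intro x hx h
    have := rex x hx
    have := imp x hx
    by_contra hn
    push Not at hn
    have := mul_nonneg hn this.le
    linarith
  have rpos : ∀ x ∈ D, 0 < x 0 → 0 ≤ (r x).re := by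
    intro x hx h
    have := rex x hx
    have := imp x hx
    by_contra hn
    push Not at hn
    have := mul_neg_of_neg_of_pos hn this
    linarith
  -- the crossing point
  obtain ⟨k, hk⟩ : ∃ k, k = 1 + a := ⟨_, rfl⟩
  have hk0 : 0 < k := by linarith
  obtain ⟨m, hm⟩ : ∃ m, m = (b*(5*k-1)) / (5*k^2-b) := ⟨_, rfl⟩
  have hden : 0 < 5*k^2-b := by nlinarith
  have hmeq : m * (5*k^2-b) = b*(5*k-1) := by rw [hm]; field_simp
  have hm0 : 0 < m := by rw [hm]; apply div_pos; · apply mul_pos hb; linarith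
                         · exact hden
  have hmk : k * m < b := by
    have : k * (m * (5*k^2-b)) < b * (5*k^2-b) := by rw [hmeq]; nlinarith
    nlinarith
  have hm1 : m < 1 := by nlinarith
  let p : Pt := ![m, b*(1-m)/k, 0]
  have hpseg : p ∈ segment ℝ ![1,0,0] ![-a,b,0] := by
    refine ⟨(m+a)/k, (1-m)/k, by positivity, ?_, ?_, ?_⟩
    · apply div_nonneg <;> linarith
    · rw [← add_div, hk]; field_simp; ring
    · ext i; fin_cases i
      · simp [p, hk]; field_simp; ring
      · simp [p]; ring
      · simp [p]
  -- description of the segments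
  have sub1 : segment ℝ ![1,0,0] p ⊆ segment ℝ ![1,0,0] ![-a,b,0] :=
    (convex_segment _ _).segment_subset (left_mem_segment ℝ _ _) hpseg
  have sub2 : segment ℝ ![-a,b,0] p ⊆ segment ℝ ![1,0,0] ![-a,b,0] :=
    (convex_segment _ _).segment_subset (right_mem_segment ℝ _ _) hpseg
  have line : ∀ x ∈ segment ℝ (![1,0,0] : Pt) ![-a,b,0], k * x 1 = b * (1 - x 0) := by
    rintro x ⟨α, β, hα, hβ, hs, rfl⟩
    obtain rfl : β = 1 - α := by linarith
    simp [hk]; ring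
  have vform : ∀ x ∈ segment ℝ (![1,0,0] : Pt) ![-a,b,0], 0 ≤ x 0 → 
      v x = x 1 + 5 * min 0 (k * x 0 - b) := by
    intro x hx h
    simp only [v]
    rw [ub x (D1 hx), hid x (D1 hx), abs_of_nonneg h, hk]
  -- segment 3 : lower edge
  have A3 : ∀ x ∈ segment ℝ (![1,0,0] : Pt) ![-a,-b,0], (s x).re ≠ 0 := by
    intro x hx
    apply Qpos; right
    refine (vle x (D3 hx)).trans ?_
    obtain ⟨α, β, hα, hβ, hs, rfl⟩ := hx
    simp; positivity
  have A2 : ∀ x ∈ segment ℝ (![-a,-b,0] : Pt) ![-a,b,0], (s x).re ≠ 0 := by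
    intro x hx
    rw [segment_symm] at hx
    apply Qpos; left
    apply rneg x (D2 hx)
    obtain ⟨α, β, hα, hβ, hs, rfl⟩ := hx
    simp; nlinarith
  have A1 : ∀ x ∈ segment ℝ (![-a,b,0] : Pt) p, (s x).re ≠ 0 := by
    intro x hx
    apply Qpos
    rcases lt_or_ge (x 0) 0 with h | h
    · left; exact rneg x (D1 (sub2 hx)) h
    · right
      have l := line x (sub2 hx)
      rw [vform x (sub2 hx) h]
      have hxm : x 0 ≤ m := by
        obtain ⟨α, β, hα, hβ, hs, rfl⟩ := hx
        obtain rfl : α = 1 - β := by linarith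
        simp [p]; nlinarith
      have e1 : min 0 (k * x 0 - b) ≤ k * x 0 - b := min_le_right _ _
      have e2 : k * (x 1 + 5 * (k * x 0 - b)) ≤ 0 := by
        have : x 0 * (5*k^2-b) ≤ m * (5*k^2-b) := by gcongr
        nlinarith
      have e3 : x 1 + 5 * (k * x 0 - b) ≤ 0 := by
        by_contra hn; push Not at hn
        have := mul_pos hk0 hn
        linarith
      linarith
  -- on the arc from (1,0,0) to p, Q = w^2
  have A4 : ∀ x ∈ segment ℝ (![1,0,0] : Pt) p, s x ^ 2 = (⟨u x, v x⟩ : ℂ)^2 := by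
    intro x hx
    have hxm : m ≤ x 0 ∧ x 0 ≤ 1 := by
      obtain ⟨α, β, hα, hβ, hs, rfl⟩ := hx
      obtain rfl : α = 1 - β := by linarith
      simp [p]; constructor <;> nlinarith
    have l := line x (sub1 hx)
    have hv0 : 0 ≤ v x := by
      rw [vform x (sub1 hx) (by linarith)]
      rcases min_choice 0 (k * x 0 - b) with e | e <;> rw [e]
      · have : 0 ≤ k * x 1 := by rw [l]; apply mul_nonneg <;> linarith
        have := nonneg_of_mul_nonneg_right this hk0
        linarith
      · have e2 : 0 ≤ k * (x 1 + 5 * (k * x 0 - b)) := by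
          have : m * (5*k^2-b) ≤ x 0 * (5*k^2-b) := by gcongr; exact hxm.1
          nlinarith
        exact nonneg_of_mul_nonneg_right e2 hk0
    rw [hs2]
    simp only [Q]
    rw [if_pos (rpos x (D1 (sub1 hx)) (by linarith)), rho, if_pos hv0]
  have w1D := D1 (left_mem_segment ℝ ![1,0,0] ![-a,b,0])
  have uw1 : 0 < u ![1,0,0] := by rw [ub _ w1D]; simp; linarith
  have vw1 : v ![1,0,0] = 0 := by
    rw [vform _ (left_mem_segment ℝ _ _) (by simp)]
    simp; linarith
  have up : u p < 0 := by
    rw [ub _ (D1 hpseg)]; simp only [p, Matrix.cons_val_zero, abs_of_pos hm0]; rw [← hk]; linarith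
  have vp : v p = 0 := by
    rw [vform _ hpseg (by simp [p]; exact hm0.le)]
    simp only [p, Matrix.cons_val_zero, Matrix.cons_val_one]
    rw [min_eq_right (by linarith)]
    field_simp
    linarith
  have zc : Continuous fun x => (s x / ⟨u x, v x⟩ : ℂ).re := by
    apply Complex.continuous_re.comp
    apply hs.div (mk_cont hu hv)
    intro x h
    rw [Complex.ext_iff] at h
    exact n2 x h
  have zn : ∀ x, (⟨u x, v x⟩ : ℂ) ≠ 0 := by
    intro x h
    rw [Complex.ext_iff] at h
    exact n2 x h
  have zz : ∀ x ∈ segment ℝ (![1,0,0] : Pt) p, (s x / ⟨u x, v x⟩ : ℂ).re ≠ 0 := by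
    intro x hx
    apply re_ne_of_sq (s := 1) one_pos
    rw [div_pow, A4 x hx, div_self (pow_ne_zero 2 (zn x))]; simp
  have dv : ∀ x, v x = 0 → (s x / ⟨u x, v x⟩ : ℂ).re = (s x).re / u x := by
    intro x hx
    have : (⟨u x, v x⟩ : ℂ) = ((u x : ℝ) : ℂ) := by rw [hx]; rfl
    rw [this, Complex.div_ofReal_re]
  -- normalise the sign
  have key : ∀ σ : ℝ, 0 < σ * (s ![1,0,0]).re → False := by
    intro σ h
    have hσ : σ ≠ 0 := by rintro rfl; simp at h
    have c1 : Continuous fun x => σ * (s x).re := by fun_prop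
    have B3 := sgn_const c1 (fun x hx => mul_ne_zero hσ (A3 x hx)) h _ (right_mem_segment ℝ _ _)
    have B2 := sgn_const c1 (fun x hx => mul_ne_zero hσ (A2 x hx)) B3 _ (right_mem_segment ℝ _ _)
    have B1 := sgn_const c1 (fun x hx => mul_ne_zero hσ (A1 x hx)) B2 _ (right_mem_segment ℝ _ _)
    have c2 : Continuous fun x => σ * (s x / ⟨u x, v x⟩ : ℂ).re := by fun_prop
    have B4 := sgn_const c2 (fun x hx => mul_ne_zero hσ (zz x hx))
      (by rw [dv _ vw1, ← mul_div_assoc]; exact div_pos h uw1) _ (right_mem_segment ℝ _ _)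
    rw [dv _ vp, ← mul_div_assoc] at B4
    exact absurd (div_neg_of_pos_of_neg B1 up) (not_lt.2 B4.le)
  have s0 := A3 _ (left_mem_segment ℝ _ _)
  exact key _ (mul_self_pos.2 s0)

lemma outl_eq (A B C : Pt) :
    outl A B C = {p | ∃ x ∈ ({A, B, C} : Set Pt), ∃ y ∈ ({A, B, C} : Set Pt), p ∈ segment ℝ x y} := by
  ext p
  constructor
  · rintro ((h | h) | h)
    · exact ⟨A, by simp, B, by simp, h⟩
    · exact ⟨B, by simp, C, by simp, h⟩
    · exact ⟨C, by simp, A, by simp, h⟩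
  · have hA : A ∈ outl A B C := Or.inl (Or.inl (left_mem_segment ℝ _ _))
    have hB : B ∈ outl A B C := Or.inl (Or.inl (right_mem_segment ℝ _ _))
    have hC : C ∈ outl A B C := Or.inl (Or.inr (right_mem_segment ℝ _ _))
    have h1 : ∀ {p}, p ∈ segment ℝ A B → p ∈ outl A B C := fun h => Or.inl (Or.inl h)
    have h2 : ∀ {p}, p ∈ segment ℝ B C → p ∈ outl A B C := fun h => Or.inl (Or.inr h)
    have h3 : ∀ {p}, p ∈ segment ℝ C A → p ∈ outl A B C := fun h => Or.inr h
    rintro ⟨x, hx, y, hy, hp⟩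
    simp only [Set.mem_insert_iff, Set.mem_singleton_iff] at hx hy
    rcases hx with rfl | rfl | rfl <;> rcases hy with rfl | rfl | rfl
    · rw [segment_same] at hp; rw [hp]; exact hA
    · exact h1 hp
    · exact h3 (by rwa [segment_symm])
    · exact h1 (by rwa [segment_symm])
    · rw [segment_same] at hp; rw [hp]; exact hB
    · exact h2 hp
    · exact h3 hp
    · exact h2 (by rwa [segment_symm])
    · rw [segment_same] at hp; rw [hp]; exact hC

lemma outline_of_vertexSet {T : Tri} {A B C : Pt} (h : T.vertexSet = {A, B, C}) :
    T.outline = outl A B C := by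
  have : T.outline = outl T.A T.B T.C := rfl
  rw [this, outl_eq, outl_eq]
  unfold Tri.vertexSet at h
  rw [h]

lemma nondeg_of_not_collinear {A B C : Pt} (h : ¬ Collinear ℝ ({A, B, C} : Set Pt)) :
    ∀ r : ℝ, C - A ≠ r • (B - A) := by
  intro r hr
  apply h
  rw [collinear_iff_of_mem (p₀ := A) (by simp)]
  refine ⟨B - A, ?_⟩
  rintro p (rfl | rfl | rfl)
  · exact ⟨0, by simp⟩
  · exact ⟨1, by simp⟩
  · exact ⟨r, by rw [← hr]; simp⟩

lemma exists_functional {A B C : Pt} (h : ∀ r : ℝ, C - A ≠ r • (B - A)) :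
    ∃ l : Pt →L[ℝ] ℝ, l (B - A) = 0 ∧ l (C - A) = 1 := by
  have : C - A ∉ Submodule.span ℝ {B - A} := by
    rw [Submodule.mem_span_singleton]
    rintro ⟨r, hr⟩
    exact h r hr.symm
  obtain ⟨g, hg, hk⟩ := Submodule.exists_le_ker_of_notMem this
  refine ⟨LinearMap.toContinuousLinearMap ((g (C - A))⁻¹ • g), ?_, ?_⟩
  · have : g (B - A) = 0 := hk (Submodule.mem_span_singleton_self _)
    simp only [LinearMap.coe_toContinuousLinearMap', LinearMap.smul_apply, this, smul_zero]
  · simp only [LinearMap.coe_toContinuousLinearMap', LinearMap.smul_apply, smul_eq_mul]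
    exact inv_mul_cancel₀ hg

lemma isCompact_segment (X Y : Pt) : IsCompact (segment ℝ X Y) := by
  rw [segment_eq_image_lineMap]
  exact isCompact_Icc.image AffineMap.lineMap_continuous

lemma isCompact_outl (A B C : Pt) : IsCompact (outl A B C) :=
  ((isCompact_segment _ _).union (isCompact_segment _ _)).union (isCompact_segment _ _)

open scoped NNReal in
lemma homeo_of_lip (g : Pt → ℝ) (K : ℝ≥0) (hg : LipschitzWith K g) (w : Pt) (hw : K * ‖w‖ < 1) :
    ∃ h : Pt ≃ₜ Pt, ∀ x, h x = x + g x • w := by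
  have happ : ApproximatesLinearOn (fun x => x + g x • w)
      ((ContinuousLinearEquiv.refl ℝ Pt : Pt ≃L[ℝ] Pt) : Pt →L[ℝ] Pt) Set.univ (K * ‖w‖₊) := by
    intro x _ y _
    have : x + g x • w - (y + g y • w) -
      ((ContinuousLinearEquiv.refl ℝ Pt : Pt ≃L[ℝ] Pt) : Pt →L[ℝ] Pt) (x - y) = (g x - g y) • w := by
      simp [sub_smul]; abel
    rw [this, norm_smul]
    have h1 := hg.dist_le_mul x y
    rw [Real.dist_eq, dist_eq_norm] at h1
    rw [Real.norm_eq_abs]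
    calc |g x - g y| * ‖w‖ ≤ (K * ‖x - y‖) * ‖w‖ := by gcongr
      _ = _ := by push_cast; ring
  refine ⟨happ.toHomeomorph _ ?_, fun x => rfl⟩
  right
  have : ‖(((ContinuousLinearEquiv.refl ℝ Pt).symm : Pt ≃L[ℝ] Pt) : Pt →L[ℝ] Pt)‖₊ = 1 := by
    have : ‖ContinuousLinearMap.id ℝ Pt‖ = 1 := ContinuousLinearMap.norm_id
    exact NNReal.eq this
  rw [this, inv_one]
  exact_mod_cast hw

def LocIso (K : Set Pt) (S S' : Set Pt) : Prop :=
  ∃ h : Pt ≃ₜ Pt, h '' S = S' ∧ ∀ x ∈ K, h x = x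

open scoped NNReal in
lemma local_iso {A B C : Pt} {K : Set Pt} (hn : ∀ r : ℝ, C - A ≠ r • (B - A)) (hK : IsCompact K)
    (hd : Disjoint (outl A B C) K) :
    ∃ δ > 0, ∀ C', dist C' C < δ → LocIso K (outl A B C) (outl A B C') := by
  classical
  obtain ⟨l, l1, l2⟩ := exists_functional hn
  have lAB : ∀ α β : ℝ, α + β = 1 → l (α • A + β • B - A) = 0 := by
    intro α β h
    have : α • A + β • B - A = β • (B - A) := by
      obtain rfl : α = 1 - β := by linarith
      module
    rw [this, map_smul, l1, smul_zero]
  have lBC : ∀ α β : ℝ, α + β = 1 → l (α • B + β • C - A) = β := by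
    intro α β h
    have : α • B + β • C - A = α • (B - A) + β • (C - A) := by
      obtain rfl : α = 1 - β := by linarith
      module
    rw [this, map_add, map_smul, map_smul, l1, l2]; simp
  have lCA : ∀ α β : ℝ, α + β = 1 → l (α • C + β • A - A) = α := by
    intro α β h
    have : α • C + β • A - A = α • (C - A) := by
      obtain rfl : α = 1 - β := by linarith
      module
    rw [this, map_smul, l2]; simp
  have lb : ∀ x ∈ outl A B C, 0 ≤ l (x - A) ∧ l (x - A) ≤ 1 := by
    rintro x ((⟨α, β, hα, hβ, hs, rfl⟩ | ⟨α, β, hα, hβ, hs, rfl⟩) | ⟨α, β, hα, hβ, hs, rfl⟩)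
    · rw [lAB _ _ hs]; simp
    · rw [lBC _ _ hs]; constructor <;> linarith
    · rw [lCA _ _ hs]; constructor <;> linarith
  obtain ⟨ρ, hρ, hρd⟩ := Metric.exists_pos_forall_lt_edist (isCompact_outl A B C) hK.isClosed hd
  have hρd' : ∀ x ∈ outl A B C, ∀ y ∈ K, (ρ : ℝ) ≤ dist x y := by
    intro x hx y hy
    have := hρd x hx y hy
    rw [edist_nndist] at this
    have : ρ < nndist x y := by exact_mod_cast this
    exact (NNReal.coe_lt_coe.2 this).le
  let g₀ : Pt → ℝ := fun x => if x ∈ outl A B C then l (x - A) else 0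
  let M : ℝ≥0 := ‖l‖₊ + ρ⁻¹
  have cross : ∀ x ∈ outl A B C, ∀ y ∈ K, |l (x - A)| ≤ M * dist x y := by
    intro x hx y hy
    have h1 := hρd' x hx y hy
    have h2 := lb x hx
    rw [abs_of_nonneg h2.1]
    have hρ' : (0:ℝ) < ρ := by exact_mod_cast hρ
    have h3 : 1 ≤ (ρ : ℝ)⁻¹ * dist x y := by
      rw [inv_mul_eq_div, le_div_iff₀ hρ']; linarith
    have h4 : 0 ≤ ‖l‖ * dist x y := by positivity
    have : (M : ℝ) = ‖l‖ + (ρ:ℝ)⁻¹ := by simp [M]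
    rw [this]; linarith
  have hg₀ : LipschitzOnWith M g₀ (outl A B C ∪ K) := by
    apply LipschitzOnWith.of_dist_le_mul
    intro x hx y hy
    rw [Real.dist_eq]
    by_cases h1 : x ∈ outl A B C <;> by_cases h2 : y ∈ outl A B C <;>
      simp only [g₀, h1, h2, if_true, if_false]
    · rw [← map_sub]
      have : x - A - (y - A) = x - y := by abel
      rw [this, dist_eq_norm]
      calc |l (x - y)| ≤ ‖l‖ * ‖x - y‖ := l.le_opNorm _
        _ ≤ M * ‖x - y‖ := by gcongr; simp [M]
    · rw [sub_zero]
      exact cross x h1 y (hy.resolve_left h2)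
    · rw [zero_sub, abs_neg, dist_comm]
      exact cross y h2 x (hx.resolve_left h1)
    · simp; positivity
  obtain ⟨g, hg, hge⟩ := hg₀.extend_real
  have gS : ∀ x ∈ outl A B C, g x = l (x - A) := by
    intro x hx
    rw [← hge (Or.inl hx)]; simp [g₀, hx]
  have gK : ∀ x ∈ K, g x = 0 := by
    intro x hx
    rw [← hge (Or.inr hx)]
    have : x ∉ outl A B C := fun h => Set.disjoint_left.1 hd h hx
    simp [g₀, this]
  refine ⟨1 / (M + 1), by positivity, fun C' hC' => ?_⟩
  obtain ⟨h, hh⟩ := homeo_of_lip g M hg (C' - C) (by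
    rw [dist_eq_norm, lt_div_iff₀ (by positivity)] at hC'
    nlinarith [norm_nonneg (C' - C)])
  have e1 : ∀ α β : ℝ, 0 ≤ α → 0 ≤ β → α + β = 1 → h (α • A + β • B) = α • A + β • B := by
    intro α β hα hβ hs
    rw [hh, gS _ (Or.inl (Or.inl ⟨α, β, hα, hβ, hs, rfl⟩)), lAB _ _ hs]; simp
  have e2 : ∀ α β : ℝ, 0 ≤ α → 0 ≤ β → α + β = 1 → h (α • B + β • C) = α • B + β • C' := by
    intro α β hα hβ hs
    rw [hh, gS _ (Or.inl (Or.inr ⟨α, β, hα, hβ, hs, rfl⟩)), lBC _ _ hs]; module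
  have e3 : ∀ α β : ℝ, 0 ≤ α → 0 ≤ β → α + β = 1 → h (α • C + β • A) = α • C' + β • A := by
    intro α β hα hβ hs
    rw [hh, gS _ (Or.inr ⟨α, β, hα, hβ, hs, rfl⟩), lCA _ _ hs]; module
  refine ⟨h, ?_, fun x hx => by rw [hh, gK x hx]; simp⟩
  ext y
  constructor
  · rintro ⟨x, (⟨α, β, hα, hβ, hs, rfl⟩ | ⟨α, β, hα, hβ, hs, rfl⟩) | ⟨α, β, hα, hβ, hs, rfl⟩, rfl⟩
    · rw [e1 _ _ hα hβ hs]; exact Or.inl (Or.inl ⟨α, β, hα, hβ, hs, rfl⟩)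
    · rw [e2 _ _ hα hβ hs]; exact Or.inl (Or.inr ⟨α, β, hα, hβ, hs, rfl⟩)
    · rw [e3 _ _ hα hβ hs]; exact Or.inr ⟨α, β, hα, hβ, hs, rfl⟩
  · rintro ((⟨α, β, hα, hβ, hs, rfl⟩ | ⟨α, β, hα, hβ, hs, rfl⟩) | ⟨α, β, hα, hβ, hs, rfl⟩)
    · exact ⟨_, Or.inl (Or.inl ⟨α, β, hα, hβ, hs, rfl⟩), e1 _ _ hα hβ hs⟩
    · exact ⟨_, Or.inl (Or.inr ⟨α, β, hα, hβ, hs, rfl⟩), e2 _ _ hα hβ hs⟩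
    · exact ⟨_, Or.inr ⟨α, β, hα, hβ, hs, rfl⟩, e3 _ _ hα hβ hs⟩

lemma LocIso.symm {K S S' : Set Pt} (h : LocIso K S S') : LocIso K S' S := by
  obtain ⟨h, rfl, h2⟩ := h
  refine ⟨h.symm, ?_, ?_⟩
  · rw [← Set.image_comp]; simp
  · intro x hx
    rw [Homeomorph.symm_apply_eq, h2 x hx]

lemma LocIso.trans {K S S' S'' : Set Pt} (h : LocIso K S S') (h' : LocIso K S' S'') :
    LocIso K S S'' := by
  obtain ⟨h, rfl, h2⟩ := h
  obtain ⟨h', rfl, h2'⟩ := h'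
  refine ⟨h.trans h', ?_, ?_⟩
  · rw [← Set.image_comp]; rfl
  · intro x hx
    simp [h2 x hx, h2' x hx]

lemma path_iso {A B : Pt} {K : Set Pt} (hK : IsCompact K) (c : ℝ → Pt) (hc : Continuous c)
    (hn : ∀ t ∈ Set.Icc (0:ℝ) 1, ∀ r : ℝ, c t - A ≠ r • (B - A))
    (hd : ∀ t ∈ Set.Icc (0:ℝ) 1, Disjoint (outl A B (c t)) K) :
    LocIso K (outl A B (c 0)) (outl A B (c 1)) := by
  apply (isPreconnected_Icc (a := (0:ℝ)) (b := 1)).induction₂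
    (fun s t => LocIso K (outl A B (c s)) (outl A B (c t)))
  · intro t ht
    obtain ⟨δ, hδ, h⟩ := local_iso (hn t ht) hK (hd t ht)
    have : ∀ᶠ s in nhds t, dist (c s) (c t) < δ := 
      hc.continuousAt.eventually (Metric.ball_mem_nhds _ hδ)
    filter_upwards [nhdsWithin_le_nhds this] with s hs
    exact h _ hs
  · intro x y z _ _ _ h1 h2; exact h1.trans h2
  · intro x y _ _ h; exact h.symm
  · simp
  · simp

lemma hull3 {A B C : Pt} {α β γ : ℝ} (hα : 0 ≤ α) (hβ : 0 ≤ β) (hγ : 0 ≤ γ) (hs : α + β + γ = 1) :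
    α • A + β • B + γ • C ∈ convexHull ℝ ({A, B, C} : Set Pt) := by
  have hA : A ∈ convexHull ℝ ({A, B, C} : Set Pt) := subset_convexHull ℝ _ (by simp)
  have hB : B ∈ convexHull ℝ ({A, B, C} : Set Pt) := subset_convexHull ℝ _ (by simp)
  have hC : C ∈ convexHull ℝ ({A, B, C} : Set Pt) := subset_convexHull ℝ _ (by simp)
  have := (convex_convexHull ℝ ({A, B, C} : Set Pt)).sum_mem (t := Finset.univ)
    (w := ![α, β, γ]) (z := ![A, B, C])
    (by intro i _; fin_cases i <;> simpa) (by simpa [Fin.sum_univ_three] using hs)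
    (by intro i _; fin_cases i <;> simpa)
  simpa [Fin.sum_univ_three] using this

lemma move_iso {A B C C' : Pt} {K : Set Pt} (hK : IsCompact K)
    (hn : ∀ r : ℝ, C - A ≠ r • (B - A)) (hn' : ∀ r : ℝ, C' - A ≠ r • (B - A))
    (hAB : Disjoint (segment ℝ A B) K)
    (hd : Disjoint (convexHull ℝ ({A, C, C'} : Set Pt) ∪ convexHull ℝ ({B, C, C'} : Set Pt)) K)
    (hBA : B ≠ A) :
    LocIso K (outl A B C) (outl A B C') := by
  -- a normal functional and vector
  obtain ⟨φ, hφB, hφC, w₀, hw₀⟩ : ∃ φ : Pt →ₗ[ℝ] ℝ, φ (B - A) = 0 ∧ φ (C - A) = 0 ∧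
      ∃ w : Pt, φ w = 1 := by
    obtain ⟨w, hw⟩ : ∃ w, w ∉ Submodule.span ℝ ({B - A, C - A} : Set Pt) := by
      by_contra hcon
      push Not at hcon
      have htop : Submodule.span ℝ ({B - A, C - A} : Set Pt) = ⊤ := by
        rw [Submodule.eq_top_iff']; exact hcon
      have h1 := finrank_span_le_card (R := ℝ) ({B - A, C - A} : Set Pt)
      rw [htop, finrank_top] at h1
      simp only [Module.finrank_fin_fun] at h1
      have h2 : ({B - A, C - A} : Set Pt).toFinset.card ≤ 2 := by
        have : ({B - A, C - A} : Set Pt).toFinset = {B - A, C - A} := by ext; simp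
        rw [this]
        exact Finset.card_le_two
      omega
    obtain ⟨g, hg, hk⟩ := Submodule.exists_le_ker_of_notMem hw
    refine ⟨g, hk (Submodule.subset_span (by simp)), hk (Submodule.subset_span (by simp)),
      (g w)⁻¹ • w, ?_⟩
    rw [map_smul, smul_eq_mul, inv_mul_cancel₀ hg]
  obtain ⟨w, hw⟩ : ∃ w : Pt, ∀ t : ℝ, 0 < t → t < 1 → ∀ ε : ℝ, 0 < ε →
      t * φ (C' - A) + t * (1 - t) * ε * φ w ≠ 0 := by
    rcases le_or_gt 0 (φ (C' - A)) with h | h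
    · refine ⟨w₀, fun t h0 h1 ε hε => ?_⟩
      have : 0 < t * (1 - t) * ε := by
        have : 0 < 1 - t := by linarith
        positivity
      rw [hw₀]
      have := mul_nonneg h0.le h
      intro h; linarith
    · refine ⟨0, fun t h0 h1 ε hε => ?_⟩
      have := mul_neg_of_pos_of_neg h0 h
      simp only [map_zero, mul_zero, add_zero]
      exact this.ne
  have hcomp : IsCompact (convexHull ℝ ({A, C, C'} : Set Pt) ∪ convexHull ℝ ({B, C, C'} : Set Pt)) :=
    (Set.Finite.isCompact_convexHull ℝ (by simp)).union
      (Set.Finite.isCompact_convexHull ℝ (by simp))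
  obtain ⟨ρ, hρ, hρd⟩ := Metric.exists_pos_forall_lt_edist hcomp hK.isClosed hd
  have hρ' : (0:ℝ) < ρ := by exact_mod_cast hρ
  have hρd' : ∀ x ∈ convexHull ℝ ({A, C, C'} : Set Pt) ∪ convexHull ℝ ({B, C, C'} : Set Pt),
      ∀ y ∈ K, (ρ : ℝ) < dist x y := by
    intro x hx y hy
    have := hρd x hx y hy
    rw [edist_nndist] at this
    have : ρ < nndist x y := by exact_mod_cast this
    exact NNReal.coe_lt_coe.2 this
  obtain ⟨ε, hε⟩ : ∃ ε : ℝ, ε = ρ / (‖w‖ + 1) := ⟨_, rfl⟩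
  have hε0 : 0 < ε := by rw [hε]; positivity
  have hεw : ε * ‖w‖ ≤ ρ := by
    rw [hε, div_mul_eq_mul_div, div_le_iff₀ (by positivity)]
    nlinarith
  let c : ℝ → Pt := fun t => (1 - t) • C + t • C' + (t * (1 - t) * ε) • w
  have hc : Continuous c := by fun_prop
  have c0 : c 0 = C := by simp [c]
  have c1 : c 1 = C' := by simp [c]
  have far : ∀ t ∈ Set.Icc (0:ℝ) 1, ∀ α β : ℝ, 0 ≤ α → 0 ≤ β → α + β = 1 → ∀ X : Pt,
      (X = A ∨ X = B) → α • X + β • c t ∉ K := by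
    intro t ht α β hα hβ hs X hX hmem
    have hin : α • X + (β * (1 - t)) • C + (β * t) • C' ∈
        convexHull ℝ ({A, C, C'} : Set Pt) ∪ convexHull ℝ ({B, C, C'} : Set Pt) := by
      have h1 : 0 ≤ β * (1 - t) := mul_nonneg hβ (by linarith [ht.2])
      have h2 : 0 ≤ β * t := mul_nonneg hβ ht.1
      have h3 : α + β * (1 - t) + β * t = 1 := by linarith
      rcases hX with rfl | rfl
      · exact Or.inl (hull3 hα h1 h2 h3)
      · exact Or.inr (hull3 hα h1 h2 h3)
    have := hρd' _ hin _ hmem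
    have e : α • X + (β * (1 - t)) • C + (β * t) • C' - (α • X + β • c t) =
        -((β * (t * (1 - t))) • (ε • w)) := by
      simp only [c]; module
    rw [dist_eq_norm, e, norm_neg, norm_smul, norm_smul, Real.norm_eq_abs, Real.norm_eq_abs,
      abs_of_pos hε0] at this
    have h4 : 0 ≤ t * (1 - t) := mul_nonneg ht.1 (by linarith [ht.2])
    have h5 : t * (1 - t) ≤ 1 := by nlinarith [ht.1, ht.2]
    have h6 : |β * (t * (1 - t))| ≤ 1 := by
      rw [abs_of_nonneg (mul_nonneg hβ h4)]
      have : β ≤ 1 := by linarith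
      nlinarith
    have h7 : 0 ≤ ε * ‖w‖ := by positivity
    nlinarith
  have := path_iso (A := A) (B := B) hK c hc ?_ ?_
  · rwa [c0, c1] at this
  · intro t ht r hr
    rcases eq_or_lt_of_le ht.1 with h0 | h0
    · rw [← h0, c0] at hr; exact hn r hr
    rcases eq_or_lt_of_le ht.2 with h1 | h1
    · rw [h1, c1] at hr; exact hn' r hr
    apply hw t h0 h1 ε hε0
    have e : c t - A = (1 - t) • (C - A) + t • (C' - A) + (t * (1 - t) * ε) • w := by
      simp only [c]; module
    rw [e] at hr
    have := congrArg φ hr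
    simpa only [map_add, map_smul, hφB, hφC, smul_eq_mul, mul_zero, zero_add] using this
  · intro t ht
    rw [Set.disjoint_left]
    rintro x ((h | ⟨α, β, hα, hβ, hs, rfl⟩) | ⟨α, β, hα, hβ, hs, rfl⟩) hx
    · exact Set.disjoint_left.1 hAB h hx
    · exact far t ht α β hα hβ hs B (Or.inr rfl) hx
    · rw [add_comm] at hx
      exact far t ht β α hβ hα (by linarith) A (Or.inl rfl) hx

def AmbIso (T T' : Fin 3 → Tri) : Prop :=
  ∃ h : Pt ≃ₜ Pt, ∀ i, h '' (T i).outline = (T' i).outline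

lemma not_collinear_of_vertexSet {T : Tri} {A B C : Pt} (h : T.vertexSet = {A, B, C}) :
    ¬ Collinear ℝ ({A, B, C} : Set Pt) := by
  rw [← h]
  exact affineIndependent_iff_not_collinear_set.1 T.indep

lemma isCompact_outline (T : Tri) : IsCompact T.outline := isCompact_outl _ _ _

lemma seg_sub_hull {A C C' : Pt} {x : Pt} {s : Set Pt} (hx : x ∈ segment ℝ A C)
    (hA : A ∈ s) (hC : C ∈ s) : x ∈ convexHull ℝ s :=
  (convex_convexHull ℝ s).segment_subset (subset_convexHull ℝ s hA) (subset_convexHull ℝ s hC) hx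

lemma elemMove_back {T T' : Fin 3 → Tri} (hm : ElemMove T T') (hL : IsLinking T') :
    IsLinking T ∧ AmbIso T T' := by
  obtain ⟨i, A, B, C, C', hv, hv', -, hj⟩ := hm
  have o := outline_of_vertexSet hv
  have o' := outline_of_vertexSet hv'
  have nc := not_collinear_of_vertexSet hv
  have nc' := not_collinear_of_vertexSet hv'
  have hBA : B ≠ A := by
    rintro rfl
    apply nc
    simp [collinear_pair]
  have hAB : ∀ j, j ≠ i → Disjoint (segment ℝ A B) (T j).outline := by
    intro j hji
    have := hL i j hji.symm
    rw [o', (hj j hji).2] at this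
    exact this.mono_left (fun x hx => Or.inl (Or.inl hx))
  have hH : ∀ j, j ≠ i → Disjoint (convexHull ℝ ({A, C, C'} : Set Pt) ∪
      convexHull ℝ ({B, C, C'} : Set Pt)) (T j).outline := fun j hji =>
    Set.disjoint_iff_inter_eq_empty.2 (hj j hji).1
  have hi : ∀ j, j ≠ i → Disjoint (T i).outline (T j).outline := by
    intro j hji
    rw [o, Set.disjoint_left]
    rintro x ((h | h) | h) hx
    · exact Set.disjoint_left.1 (hAB j hji) h hx
    · exact Set.disjoint_left.1 (hH j hji)
        (Or.inr (seg_sub_hull (C' := C') h (by simp) (by simp))) hx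
    · exact Set.disjoint_left.1 (hH j hji)
        (Or.inl (seg_sub_hull (C' := C') h (by simp) (by simp))) hx
  constructor
  · intro j k hjk
    by_cases h1 : j = i
    · subst h1; exact hi k hjk.symm
    by_cases h2 : k = i
    · subst h2; exact (hi j hjk).symm
    rw [← (hj j h1).2, ← (hj k h2).2]
    exact hL j k hjk
  · have hK : IsCompact (⋃ j ∈ {j : Fin 3 | j ≠ i}, (T j).outline) :=
      (Set.toFinite _).isCompact_biUnion fun j _ => isCompact_outline _
    obtain ⟨h, h1, h2⟩ := move_iso hK (nondeg_of_not_collinear nc) (nondeg_of_not_collinear nc')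
      (Set.disjoint_iUnion₂_right.2 hAB) (Set.disjoint_iUnion₂_right.2 hH) hBA
    refine ⟨h, fun j => ?_⟩
    by_cases hji : j = i
    · subst hji; rw [o, o', h1]
    · rw [(hj j hji).2]
      have : ∀ x ∈ (T j).outline, h x = x := fun x hx => h2 x (Set.mem_biUnion (by exact hji) hx)
      rw [Set.image_congr this, Set.image_id']

lemma combIso_amb {T T' : Fin 3 → Tri} (hL : IsLinking T') (h : CombIsotopic T T') :
    AmbIso T T' := by
  suffices IsLinking T ∧ AmbIso T T' from this.2
  induction h using Relation.ReflTransGen.head_induction_on with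
  | refl => exact ⟨hL, Homeomorph.refl _, fun i => by simp⟩
  | head h1 _ ih =>
    obtain ⟨h, hh⟩ := ih.2
    obtain ⟨l, g, hg⟩ := elemMove_back h1 ih.1
    refine ⟨l, g.trans h, fun i => ?_⟩
    rw [← hh i, ← hg i, ← Set.image_comp]; rfl

lemma exists_retract (T : Tri) : ∃ f : Pt → Pt, Continuous f ∧ (∀ x, f x ∈ T.hull) ∧
    ∀ x ∈ T.outline, f x = x := by
  have nc := not_collinear_of_vertexSet (T := T) rfl
  obtain ⟨A, B, C, hT⟩ := T
  simp only [Tri.hull, Tri.outline] at *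
  obtain ⟨ψ, ψB, ψC⟩ := exists_functional (nondeg_of_not_collinear nc)
  have nc' : ¬ Collinear ℝ ({A, C, B} : Set Pt) := by rwa [Set.pair_comm C B]
  obtain ⟨φ, φC, φB⟩ := exists_functional (nondeg_of_not_collinear nc')
  let s : Pt → ℝ := fun x => max 0 (min 1 (φ (x - A)))
  let t : Pt → ℝ := fun x => max 0 (min (1 - s x) (ψ (x - A)))
  have s0 : ∀ x, 0 ≤ s x := fun x => le_max_left _ _
  have t0 : ∀ x, 0 ≤ t x := fun x => le_max_left _ _
  have s1 : ∀ x, s x ≤ 1 := fun x => max_le zero_le_one (min_le_left _ _)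
  have t1 : ∀ x, t x ≤ 1 - s x := fun x => max_le (by linarith [s1 x]) (min_le_left _ _)
  have sc : Continuous s := by fun_prop
  have tc : Continuous t := by fun_prop
  have key : ∀ α β γ : ℝ, 0 ≤ α → 0 ≤ β → 0 ≤ γ → α + β + γ = 1 →
      s (α • A + β • B + γ • C) = β ∧ t (α • A + β • B + γ • C) = γ := by
    intro α β γ hα hβ hγ hs
    have e : α • A + β • B + γ • C - A = β • (B - A) + γ • (C - A) := by
      obtain rfl : α = 1 - β - γ := by linarith
      module
    have hs' : s (α • A + β • B + γ • C) = β := by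
      simp only [s]
      rw [e, map_add, map_smul, map_smul, φB, φC]
      simp only [smul_eq_mul, mul_one, mul_zero, add_zero]
      rw [min_eq_right (by linarith), max_eq_right hβ]
    refine ⟨hs', ?_⟩
    simp only [t]
    rw [hs', e, map_add, map_smul, map_smul, ψB, ψC]
    simp only [smul_eq_mul, mul_one, mul_zero, zero_add]
    rw [min_eq_right (by linarith), max_eq_right hγ]
  refine ⟨fun x => (1 - s x - t x) • A + s x • B + t x • C, by fun_prop, fun x => ?_, ?_⟩
  · exact hull3 (by linarith [t1 x]) (s0 x) (t0 x) (by ring)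
  · have k2 : ∀ α β γ : ℝ, 0 ≤ α → 0 ≤ β → 0 ≤ γ → α + β + γ = 1 → ∀ x, 
      x = α • A + β • B + γ • C → (1 - s x - t x) • A + s x • B + t x • C = x := by
      intro α β γ hα hβ hγ hs x hx
      obtain ⟨h1, h2⟩ := key α β γ hα hβ hγ hs
      rw [← hx] at h1 h2
      rw [h1, h2, hx]
      obtain rfl : α = 1 - β - γ := by linarith
      rfl
    rintro x ((⟨α, β, hα, hβ, hs, h⟩ | ⟨α, β, hα, hβ, hs, h⟩) | ⟨α, β, hα, hβ, hs, h⟩)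
    · exact k2 α β 0 hα hβ le_rfl (by linarith) x (by rw [← h]; module)
    · exact k2 0 α β le_rfl hα hβ (by linarith) x (by rw [← h]; module)
    · exact k2 β 0 α hβ le_rfl hα (by linarith) x (by rw [← h]; module)

lemma outline_sub_hull (T : Tri) : T.outline ⊆ T.hull := by
  rintro x ((h | h) | h)
  · exact seg_sub_hull (C' := T.A) h (by simp) (by simp)
  · exact seg_sub_hull (C' := T.A) h (by simp) (by simp)
  · exact seg_sub_hull (C' := T.A) h (by simp) (by simp)

/-- The Valknut linking is not combinatorially isotopic (for any ordering of the triangles)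
to any linking of three triangles whose convex hulls are pairwise disjoint. -/
theorem stmt5 (T : Fin 3 → Tri) (hV : IsValknut T)
    (T' : Fin 3 → Tri) (hT' : IsLinking T')
    (hd : ∀ i j, i ≠ j → Disjoint (T' i).hull (T' j).hull)
    (e : Equiv.Perm (Fin 3)) :
    ¬ CombIsotopic T (T' ∘ ⇑e) := by
  intro hiso
  have hL : IsLinking (T' ∘ e) := fun i j hij => hT' _ _ (fun h => hij (e.injective h))
  obtain ⟨h, hh⟩ := combIso_amb hL hiso
  obtain ⟨f, hf, hfh, hfo⟩ := exists_retract (T' (e 0))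
  have av : ∀ j, j ≠ 0 → ∀ x, h.symm (f (h x)) ∉ (T j).outline := by
    intro j hj x hx
    have h1 : f (h x) ∈ (T' (e j)).outline := by
      have := hh j
      simp only [Function.comp] at this
      rw [← this]
      exact ⟨_, hx, by simp⟩
    exact Set.disjoint_left.1 (hd (e 0) (e j) (fun h => hj (e.injective h).symm)) (hfh _)
      (outline_sub_hull _ h1)
  have hid : ∀ x ∈ (T 0).outline, h.symm (f (h x)) = x := by
    intro x hx
    rw [hfo (h x), h.symm_apply_apply]
    have := hh 0
    simp only [Function.comp] at this
    rw [← this]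
    exact ⟨x, hx, rfl⟩
  have av1 := av 1 (by decide)
  have av2 := av 2 (by decide)
  obtain ⟨v0, v1, v2⟩ := hV
  rw [outline_of_vertexSet v0] at hid
  rw [outline_of_vertexSet v1] at av1
  rw [outline_of_vertexSet v2] at av2
  have h5 : (0:ℝ) < Real.sqrt 5 := by positivity
  have h10 : (0:ℝ) < Real.sqrt 10 := by positivity
  have w2 : w₂ = ![-(2 / Real.sqrt 5), 1 / Real.sqrt 10, 0] := by
    rw [w₂, neg_div]
  have w3 : w₃ = ![-(2 / Real.sqrt 5), -(1 / Real.sqrt 10), 0] := by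
    rw [w₃, neg_div, neg_div]
  refine no_disc (2 / Real.sqrt 5) (1 / Real.sqrt 10) ?_ ?_ (by positivity) (by positivity)
    (fun x => h.symm (f (h x))) (by fun_prop) ?_ ?_ ?_
  · rw [div_pow, Real.sq_sqrt (by norm_num)]; norm_num
  · rw [div_pow, Real.sq_sqrt (by norm_num)]; norm_num
  · rw [w2, w3] at hid; exact hid
  · rw [w2, w3] at av1; exact av1
  · rw [w2, w3] at av2; exact av2
end
end

section
/- The Valknut linking is a linking of three triangles (the three outlines are pairwise disjoint) and it is Borromean: the convex hulls of the three triangles have a common point and, in the enumeration Δ1, Δ2, Δ3, each set ∂Δj ∩ ⟨Δ_{(j mod 3)+1}⟩ consists of exactly two points. -/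
open scoped Matrix

noncomputable section

def ptv (i : Fin 3) (u v : ℝ) : Pt := fun k => if k = i then u else if k = i + 1 then v else 0

lemma ptv_0 (i : Fin 3) (u v : ℝ) : ptv i u v i = u := by simp [ptv]
lemma ptv_1 (i : Fin 3) (u v : ℝ) : ptv i u v (i+1) = v := by fin_cases i <;> simp [ptv]
lemma ptv_2 (i : Fin 3) (u v : ℝ) : ptv i u v (i+2) = 0 := by fin_cases i <;> simp [ptv]

lemma pt_ext (i : Fin 3) (p q : Pt) (h0 : p i = q i) (h1 : p (i+1) = q (i+1))
    (h2 : p (i+2) = q (i+2)) : p = q := by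
  ext k
  have : k = i ∨ k = i + 1 ∨ k = i + 2 := by clear h0 h1 h2; revert i k; decide
  rcases this with rfl | rfl | rfl <;> assumption

lemma mem_seg (i : Fin 3) (u v u' v' : ℝ) (p : Pt) :
    p ∈ segment ℝ (ptv i u v) (ptv i u' v') ↔
      ∃ s t : ℝ, 0 ≤ s ∧ 0 ≤ t ∧ s + t = 1 ∧ p i = s * u + t * u' ∧ p (i+1) = s * v + t * v' ∧
        p (i+2) = 0 := by
  constructor
  · rintro ⟨s, t, hs, ht, hst, rfl⟩
    refine ⟨s, t, hs, ht, hst, ?_, ?_, ?_⟩ <;> simp [ptv_0, ptv_1, ptv_2]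
  · rintro ⟨s, t, hs, ht, hst, h0, h1, h2⟩
    refine ⟨s, t, hs, ht, hst, ?_⟩
    apply pt_ext i <;> simp [ptv_0, ptv_1, ptv_2, h0, h1, h2]

def vtri (a b : ℝ) (ha : 0 < a) (hb : 0 < b) (i : Fin 3) : Tri where
  A := ptv i 1 0
  B := ptv i (-a) b
  C := ptv i (-a) (-b)
  indep := by
    rw [affineIndependent_iff_of_fintype]
    intro w hw h
    rw [Finset.weightedVSub_eq_weightedVSubOfPoint_of_sum_eq_zero _ w _ hw 0] at h
    simp only [Finset.weightedVSubOfPoint_apply, Fin.sum_univ_three] at h hw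
    have h0 := congrFun h i
    have h1 := congrFun h (i+1)
    simp [ptv_0, ptv_1] at h0 h1
    have e12 : w 1 = w 2 := by
      have : (w 1 - w 2) * b = 0 := by linarith
      have := (mul_eq_zero.1 this).resolve_right hb.ne'
      linarith
    have e2 : w 2 = 0 := by
      have : w 2 * (1 + a) = 0 := by rw [e12] at h0 hw; linarith
      exact (mul_eq_zero.1 this).resolve_right (by positivity)
    intro k
    fin_cases k
    · show w 0 = 0
      linarith
    · show w 1 = 0
      linarith
    · exact e2

section
variable (a b : ℝ) (ha : 0 < a) (hb : 0 < b) (i : Fin 3)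

lemma outline_hull (p : Pt) (T : Tri) (h : p ∈ T.outline) : p ∈ T.hull := by
  have hc : Convex ℝ T.hull := convex_convexHull ℝ _
  have hs : ({T.A, T.B, T.C} : Set Pt) ⊆ T.hull := subset_convexHull ℝ _
  have hA : T.A ∈ T.hull := hs (by simp)
  have hB : T.B ∈ T.hull := hs (by simp)
  have hC : T.C ∈ T.hull := hs (by simp)
  rcases h with (h | h) | h
  · exact hc.segment_subset hA hB h
  · exact hc.segment_subset hB hC h
  · exact hc.segment_subset hC hA h

lemma hull_plane (p : Pt) (h : p ∈ (vtri a b ha hb i).hull) : p (i+2) = 0 := by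
  have hc : Convex ℝ {q : Pt | q (i+2) = 0} := by
    intro x hx y hy s t _ _ _
    simp only [Set.mem_ofPred_eq] at *
    simp [hx, hy]
  have : (vtri a b ha hb i).hull ⊆ {q : Pt | q (i+2) = 0} := by
    apply convexHull_min _ hc
    rintro q (rfl | rfl | rfl) <;> simp [vtri, ptv_2]
  exact this h

lemma axis_mem (y : ℝ) (h1 : -a ≤ y) (h2 : y ≤ 1) :
    ptv i y 0 ∈ (vtri a b ha hb i).hull := by
  have hc : Convex ℝ (vtri a b ha hb i).hull := convex_convexHull ℝ _
  have hs : ({ptv i 1 0, ptv i (-a) b, ptv i (-a) (-b)} : Set Pt) ⊆ (vtri a b ha hb i).hull :=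
    subset_convexHull ℝ _
  have hM : ptv i (-a) 0 ∈ (vtri a b ha hb i).hull := by
    refine hc.segment_subset (hs (a := ptv i (-a) b) (by simp))
      (hs (a := ptv i (-a) (-b)) (by simp)) ?_
    rw [mem_seg]
    refine ⟨1/2, 1/2, by norm_num, by norm_num, by norm_num, ?_, ?_, ?_⟩ <;>
      simp only [ptv_0, ptv_1, ptv_2] <;> ring
  refine hc.segment_subset (hs (a := ptv i 1 0) (by simp)) hM ?_
  rw [mem_seg]
  have : 1 + a ≠ 0 := by positivity
  refine ⟨(y+a)/(1+a), (1-y)/(1+a), by apply div_nonneg <;> linarith,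
    by apply div_nonneg <;> linarith, by field_simp; ring, ?_, ?_, ?_⟩ <;>
      simp only [ptv_0, ptv_1, ptv_2] <;> field_simp <;> ring

lemma inter_eq (hba : b < a) (hb1 : b < 1) :
    (vtri a b ha hb i).outline ∩ (vtri a b ha hb (i+1)).hull =
      {ptv (i+1) (b/(1+a)) 0, ptv (i+1) (-(b/(1+a))) 0} := by
  have hne : 1 + a ≠ 0 := by positivity
  have hc0 : 0 < b / (1+a) := by positivity
  have hcb : b / (1+a) < b := div_lt_self hb (by linarith)
  have e1 : i + 1 + 1 = i + 2 := by rw [add_assoc]; rfl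
  have e2 : i + 1 + 2 = i := by revert i; decide
  have key : ∀ y, ptv (i+1) y 0 i = 0 ∧ ptv (i+1) y 0 (i+1) = y ∧ ptv (i+1) y 0 (i+2) = 0 := by
    intro y
    refine ⟨?_, ptv_0 _ _ _, ?_⟩
    · have := ptv_2 (i+1) y 0; rwa [e2] at this
    · have := ptv_1 (i+1) y 0; rwa [e1] at this
  apply Set.Subset.antisymm
  · rintro p ⟨ho, hh⟩
    have h0 := hull_plane a b ha hb (i+1) p hh
    rw [e2] at h0
    rcases ho with (h | h) | h
    · obtain ⟨s, t, hs, ht, hst, p0, p1, p2⟩ := (mem_seg ..).1 h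
      left
      have ht : t = 1 / (1+a) := by
        rw [eq_div_iff hne]; linarith
      apply pt_ext i
      · rw [(key _).1, h0]
      · rw [(key _).2.1, p1, ht]; ring
      · rw [(key _).2.2, p2]
    · obtain ⟨s, t, hs, ht, hst, p0, p1, p2⟩ := (mem_seg ..).1 h
      exfalso
      have : p i = -a := by rw [p0, ← add_mul, hst]; ring
      linarith
    · obtain ⟨s, t, hs, ht, hst, p0, p1, p2⟩ := (mem_seg ..).1 h
      right
      have ht : s = 1 / (1+a) := by
        rw [eq_div_iff hne]; linarith
      apply pt_ext i
      · rw [(key _).1, h0]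
      · rw [(key _).2.1, p1, ht]; ring
      · rw [(key _).2.2, p2]
  · rintro p (rfl | rfl)
    · refine ⟨Or.inl (Or.inl ?_), axis_mem _ _ _ _ _ _ (by linarith) (by linarith)⟩
      refine (mem_seg ..).2 ⟨a/(1+a), 1/(1+a), by positivity, by positivity, by field_simp; ring,
        ?_, ?_, (key _).2.2⟩
      · rw [(key _).1]; field_simp; ring
      · rw [(key _).2.1]; field_simp; ring
    · refine ⟨Or.inr ?_, axis_mem _ _ _ _ _ _ (by linarith) (by linarith)⟩
      refine (mem_seg ..).2 ⟨1/(1+a), a/(1+a), by positivity, by positivity, by field_simp,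
        ?_, ?_, (key _).2.2⟩
      · rw [(key _).1]; field_simp; ring
      · rw [(key _).2.1]; field_simp; ring

lemma axis_not (y : ℝ) (h1 : -a < y) (h2 : y < 1) :
    ptv i y 0 ∉ (vtri a b ha hb i).outline := by
  rintro ((h | h) | h) <;> obtain ⟨s, t, hs, ht, hst, p0, p1, p2⟩ := (mem_seg ..).1 h <;>
    rw [ptv_0] at p0 <;> rw [ptv_1] at p1
  · have : t = 0 := by
      have : t * b = 0 := by linarith
      simpa [hb.ne'] using this
    subst this
    linarith
  · have : y = -a := by rw [p0, ← add_mul, hst]; ring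
    linarith
  · have : s = 0 := by
      have : s * b = 0 := by linarith
      simpa [hb.ne'] using this
    subst this
    linarith

lemma disj (hba : b < a) (hb1 : b < 1) :
    Disjoint (vtri a b ha hb i).outline (vtri a b ha hb (i+1)).outline := by
  have hc0 : 0 < b / (1+a) := by positivity
  have hcb : b / (1+a) < b := div_lt_self hb (by linarith)
  rw [Set.disjoint_left]
  intro p hp hq
  have : p ∈ (vtri a b ha hb i).outline ∩ (vtri a b ha hb (i+1)).hull :=
    ⟨hp, outline_hull _ _ hq⟩
  rw [inter_eq a b ha hb i hba hb1] at this
  rcases this with rfl | rfl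
  · exact axis_not _ _ _ _ _ _ (by linarith) (by linarith) hq
  · exact axis_not _ _ _ _ _ _ (by linarith) (by linarith) hq

end

/-- The Valknut linking is a linking of three triangles and it is Borromean: the three
convex hulls have a common point and each `∂Δj ∩ ⟨Δ_{(j mod 3)+1}⟩` consists of exactly two
points. -/
theorem stmt6 :
    ∃ T : Fin 3 → Tri, IsValknut T ∧ IsLinking T ∧
      ((T 0).hull ∩ (T 1).hull ∩ (T 2).hull).Nonempty ∧
      ∀ j : Fin 3, ∃ P Q : Pt, P ≠ Q ∧ (T j).outline ∩ (T (j + 1)).hull = {P, Q} := by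
  have ha : 0 < 2 / Real.sqrt 5 := by positivity
  have hb : 0 < 1 / Real.sqrt 10 := by positivity
  have h510 : Real.sqrt 5 < Real.sqrt 10 := Real.sqrt_lt_sqrt (by norm_num) (by norm_num)
  have h5 : 1 < Real.sqrt 5 := by rw [Real.lt_sqrt] <;> norm_num
  have hba : 1 / Real.sqrt 10 < 2 / Real.sqrt 5 := by
    rw [div_lt_div_iff₀ (by positivity) (by positivity)]; linarith
  have hb1 : 1 / Real.sqrt 10 < 1 := by
    rw [div_lt_one (by positivity)]; linarith
  have hc0 : 0 < 1 / Real.sqrt 10 / (1 + 2 / Real.sqrt 5) := by positivity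
  refine ⟨vtri _ _ ha hb, ⟨?_, ?_, ?_⟩, ?_, ⟨0, ?_⟩, fun j => ⟨_, _, ?_, inter_eq _ _ ha hb j hba hb1⟩⟩
  · have h1 : ptv 0 1 0 = w₁ := by ext k; fin_cases k <;> simp [ptv, w₁]
    have h2 : ptv 0 (-(2 / Real.sqrt 5)) (1 / Real.sqrt 10) = w₂ := by
      ext k; fin_cases k <;> simp [ptv, w₂, neg_div]
    have h3 : ptv 0 (-(2 / Real.sqrt 5)) (-(1 / Real.sqrt 10)) = w₃ := by
      ext k; fin_cases k <;> simp [ptv, w₃, neg_div]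
    simp only [Tri.vertexSet, vtri, h1, h2, h3]
  · have h1 : ptv 1 1 0 = cyc w₁ := by ext k; fin_cases k <;> simp [ptv, w₁, cyc]
    have h2 : ptv 1 (-(2 / Real.sqrt 5)) (1 / Real.sqrt 10) = cyc w₂ := by
      ext k; fin_cases k <;> simp [ptv, w₂, neg_div, cyc]
    have h3 : ptv 1 (-(2 / Real.sqrt 5)) (-(1 / Real.sqrt 10)) = cyc w₃ := by
      ext k; fin_cases k <;> simp [ptv, w₃, neg_div, cyc]
    simp only [Tri.vertexSet, vtri, h1, h2, h3]
  · have h1 : ptv 2 1 0 = cyc (cyc w₁) := by ext k; fin_cases k <;> simp [ptv, w₁, cyc]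
    have h2 : ptv 2 (-(2 / Real.sqrt 5)) (1 / Real.sqrt 10) = cyc (cyc w₂) := by
      ext k; fin_cases k <;> simp [ptv, w₂, neg_div, cyc]
    have h3 : ptv 2 (-(2 / Real.sqrt 5)) (-(1 / Real.sqrt 10)) = cyc (cyc w₃) := by
      ext k; fin_cases k <;> simp [ptv, w₃, neg_div, cyc]
    simp only [Tri.vertexSet, vtri, h1, h2, h3]
  · intro i j hij
    have : j = i + 1 ∨ i = j + 1 := by revert i j; decide
    rcases this with rfl | rfl
    · exact disj _ _ ha hb _ hba hb1
    · exact (disj _ _ ha hb _ hba hb1).symm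
  · have h : ∀ i, (0 : Pt) ∈ (vtri _ _ ha hb i).hull := by
      intro i
      have := axis_mem _ _ ha hb i 0 (by linarith) (by norm_num)
      have e : ptv i 0 0 = 0 := by ext k; simp [ptv]
      rwa [e] at this
    exact ⟨⟨h 0, h 1⟩, h 2⟩
  · intro h
    have := congrFun h (j+1)
    rw [ptv_0, ptv_0] at this
    linarith
end
end

section
/- Let Λ0 and Λ1 be triangles in ℝ³ with disjoint outlines. If ⟨Λ0⟩ ∩ ⟨Λ1⟩ ≠ ∅, then ∂Λ0 ∩ ⟨Λ1⟩ ≠ ∅ or ∂Λ1 ∩ ⟨Λ0⟩ ≠ ∅. -/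
open scoped Matrix

noncomputable section

theorem aux_shift (c w : Fin 6 → ℝ) (hc : ∀ i, 0 ≤ c i) (hw : ∃ i, w i < 0) :
    ∃ t : ℝ, (∀ i, 0 ≤ c i + t * w i) ∧ ∃ i, c i + t * w i = 0 := by
  obtain ⟨i0, hi0⟩ := hw
  obtain ⟨m, hm, hmin⟩ := Finset.exists_min_image (Finset.univ.filter (fun i => w i < 0))
    (fun i => c i / (- w i)) ⟨i0, by simpa using hi0⟩
  have hm' : w m < 0 := by simpa using hm
  refine ⟨c m / (- w m), fun i => ?_, m, ?_⟩
  · rcases lt_or_ge (w i) 0 with hi | hi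
    · have h1 := hmin i (by simpa using hi)
      rw [le_div_iff₀ (by linarith)] at h1
      linarith
    · have : 0 ≤ c m / (- w m) := div_nonneg (hc m) (by linarith)
      have := mul_nonneg this hi
      linarith [hc i]
  · have : w m ≠ 0 := hm'.ne
    field_simp
    ring

theorem aux_hull (A B C x : Pt) : x ∈ convexHull ℝ ({A, B, C} : Set Pt) ↔
    ∃ a b c : ℝ, 0 ≤ a ∧ 0 ≤ b ∧ 0 ≤ c ∧ a + b + c = 1 ∧ a • A + b • B + c • C = x := by
  rw [convexHull_insert (by simp), convexHull_pair, mem_convexJoin]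
  constructor
  · rintro ⟨y, hy, z, ⟨p, q, hp, hq, hpq, rfl⟩, ⟨r, s, hr, hs, hrs, rfl⟩⟩
    obtain rfl : y = A := hy
    refine ⟨r, s * p, s * q, hr, by positivity, by positivity, ?_, ?_⟩
    · rw [add_assoc, ← mul_add, hpq, mul_one, hrs]
    · module
  · rintro ⟨a, b, c, ha, hb, hc, hs, rfl⟩
    refine ⟨A, rfl, ?_⟩
    rcases (add_nonneg hb hc).eq_or_lt with h0 | h0
    · have hb0 : b = 0 := by linarith
      have hc0 : c = 0 := by linarith
      refine ⟨B, left_mem_segment _ _ _, a, 0, ha, le_rfl, by linarith, ?_⟩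
      simp [hb0, hc0]
    · refine ⟨(b / (b + c)) • B + (c / (b + c)) • C,
        ⟨_, _, by positivity, by positivity, by field_simp, rfl⟩,
        a, b + c, ha, h0.le, by linarith, ?_⟩
      rw [smul_add, smul_smul, smul_smul, mul_div_cancel₀ _ h0.ne', mul_div_cancel₀ _ h0.ne',
        add_assoc]

theorem aux_outline (T : Tri) (a b c : ℝ) (ha : 0 ≤ a) (hb : 0 ≤ b) (hc : 0 ≤ c)
    (hs : a + b + c = 1) (h0 : a = 0 ∨ b = 0 ∨ c = 0) :
    a • T.A + b • T.B + c • T.C ∈ T.outline := by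
  rcases h0 with rfl | rfl | rfl
  · exact Or.inl (Or.inr ⟨b, c, hb, hc, by linarith, by module⟩)
  · exact Or.inr ⟨c, a, hc, ha, by linarith, by module⟩
  · exact Or.inl (Or.inl ⟨a, b, ha, hb, by linarith, by module⟩)

/-- If two triangles with disjoint outlines have intersecting convex hulls, then the outline
of one of them meets the convex hull of the other. -/
theorem stmt12 (Λ0 Λ1 : Tri) (h : Disjoint Λ0.outline Λ1.outline)
    (hne : (Λ0.hull ∩ Λ1.hull).Nonempty) :
    (Λ0.outline ∩ Λ1.hull).Nonempty ∨ (Λ1.outline ∩ Λ0.hull).Nonempty := by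
  obtain ⟨x, hx0, hx1⟩ := hne
  obtain ⟨a, b, c, ha, hb, hc, hs, hx⟩ := (aux_hull _ _ _ _).1 hx0
  obtain ⟨d, e, f, hd, he, hf, hs', hx'⟩ := (aux_hull _ _ _ _).1 hx1
  let v : Fin 6 → Pt × ℝ × ℝ := ![(Λ0.A, 1, 0), (Λ0.B, 1, 0), (Λ0.C, 1, 0),
    (-Λ1.A, 0, 1), (-Λ1.B, 0, 1), (-Λ1.C, 0, 1)]
  have hv : ¬ LinearIndependent ℝ v := by
    intro hv
    have := hv.fintype_card_le_finrank
    simp at this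
  obtain ⟨g, hg, i, hi⟩ := Fintype.not_linearIndependent_iff.1 hv
  simp only [Fin.sum_univ_six] at hg
  have hg1 := congrArg Prod.fst hg
  have hg2 := congrArg (fun p => p.2.1) hg
  have hg3 := congrArg (fun p => p.2.2) hg
  simp [v] at hg1 hg2 hg3
  have hneg : ∃ i, g i < 0 := by
    by_contra! hcon
    have h0 := hcon 0
    have h1 := hcon 1
    have h2 := hcon 2
    have h3 := hcon 3
    have h4 := hcon 4
    have h5 := hcon 5
    apply hi
    fin_cases i <;> simp <;> linarith
  obtain ⟨t, ht, j, hj⟩ := aux_shift ![a, b, c, d, e, f] g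
    (by intro i; fin_cases i <;> simpa) hneg
  have h0 := ht 0
  have h1 := ht 1
  have h2 := ht 2
  have h3 := ht 3
  have h4 := ht 4
  have h5 := ht 5
  simp at h0 h1 h2 h3 h4 h5
  have hS : (a + t * g 0) + (b + t * g 1) + (c + t * g 2) = 1 := by
    linear_combination hs + t * hg2
  have hS' : (d + t * g 3) + (e + t * g 4) + (f + t * g 5) = 1 := by
    linear_combination hs' + t * hg3
  have key : (a + t * g 0) • Λ0.A + (b + t * g 1) • Λ0.B + (c + t * g 2) • Λ0.C =
      (d + t * g 3) • Λ1.A + (e + t * g 4) • Λ1.B + (f + t * g 5) • Λ1.C := by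
    linear_combination (norm := module) hx - hx' + t • hg1
  have hor : ((a + t * g 0) = 0 ∨ (b + t * g 1) = 0 ∨ (c + t * g 2) = 0) ∨
      ((d + t * g 3) = 0 ∨ (e + t * g 4) = 0 ∨ (f + t * g 5) = 0) := by
    fin_cases j <;> simp at hj <;> simp [hj]
  rcases hor with hor | hor
  · left
    refine ⟨_, aux_outline Λ0 _ _ _ h0 h1 h2 hS hor, ?_⟩
    exact (aux_hull _ _ _ _).2 ⟨_, _, _, h3, h4, h5, hS', key.symm⟩
  · right
    refine ⟨_, aux_outline Λ1 _ _ _ h3 h4 h5 hS' hor, ?_⟩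
    exact (aux_hull _ _ _ _).2 ⟨_, _, _, h0, h1, h2, hS, key⟩
end
end

section
/- Let Λ1 and Λ2 be triangles in ℝ³ with disjoint outlines. If ∂Λ1 ∩ ⟨Λ2⟩ consists of exactly two points, then ∂Λ2 ∩ ⟨Λ1⟩ = ∅. -/
open scoped Matrix

noncomputable section

def IsAff (f : Pt → ℝ) : Prop :=
  ∀ (A B C : Pt) (a b c : ℝ), a + b + c = 1 → f (a • A + b • B + c • C) = a * f A + b * f B + c * f C

lemma isAff_of (n : Pt) (k : ℝ) : IsAff (fun p => n ⬝ᵥ p + k) := by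
  intro A B C a b c h
  simp only [dotProduct_add, dotProduct_smul, smul_eq_mul]
  linear_combination (-k) * h

lemma IsAff.line {f : Pt → ℝ} (h : IsAff f) (P Q : Pt) (s : ℝ) :
    f ((1 - s) • P + s • Q) = (1 - s) * f P + s * f Q := by
  have := h P Q 0 (1 - s) s 0 (by ring)
  simpa using this

lemma mem_hull3 (A B C p : Pt) : p ∈ convexHull ℝ ({A, B, C} : Set Pt) ↔
    ∃ a b c : ℝ, 0 ≤ a ∧ 0 ≤ b ∧ 0 ≤ c ∧ a + b + c = 1 ∧ p = a • A + b • B + c • C := by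
  constructor
  · intro hp
    rw [convexHull_insert (by simp), convexHull_pair] at hp
    simp only [convexJoin_singleton_left, Set.mem_iUnion] at hp
    obtain ⟨y, ⟨a, b, ha, hb, hab, rfl⟩, ⟨c, d, hc, hd, hcd, rfl⟩⟩ := hp
    refine ⟨c, d * a, d * b, hc, by positivity, by positivity, ?_, ?_⟩
    · linear_combination hcd + d * hab
    · simp only [smul_add, smul_smul, add_assoc]
  · rintro ⟨a, b, c, ha, hb, hc, h, rfl⟩
    have hA : A ∈ convexHull ℝ ({A, B, C} : Set Pt) := subset_convexHull _ _ (by simp)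
    have hB : B ∈ convexHull ℝ ({A, B, C} : Set Pt) := subset_convexHull _ _ (by simp)
    have hC : C ∈ convexHull ℝ ({A, B, C} : Set Pt) := subset_convexHull _ _ (by simp)
    have hcv := convex_convexHull ℝ ({A, B, C} : Set Pt)
    have := hcv.sum_mem (t := Finset.univ) (w := ![a, b, c]) (z := ![A, B, C])
      (by intro i _; fin_cases i <;> simpa) (by simp [Fin.sum_univ_three, h])
      (by intro i _; fin_cases i <;> simpa)
    simpa [Fin.sum_univ_three] using this

lemma exists_coord (D E F : Pt) (h : AffineIndependent ℝ ![D, E, F]) :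
    ∃ u v w z : Pt → ℝ, IsAff u ∧ IsAff v ∧ IsAff w ∧ IsAff z ∧
      (u D = 1 ∧ u E = 0 ∧ u F = 0) ∧ (v D = 0 ∧ v E = 1 ∧ v F = 0) ∧
      (w D = 0 ∧ w E = 0 ∧ w F = 1) ∧ (z D = 0 ∧ z E = 0 ∧ z F = 0) ∧
      (∀ p, u p + v p + w p = 1) ∧
      (∀ p, z p = 0 → p = u p • D + v p • E + w p • F) := by
  have hl : LinearIndependent ℝ ![E - D, F - D] := by
    rw [affineIndependent_iff_linearIndependent_vsub ℝ _ (0 : Fin 3)] at h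
    have := h.comp (fun i : Fin 2 => (⟨i.succ, Fin.succ_ne_zero i⟩ : {x : Fin 3 // x ≠ 0}))
      (by intro i j hij; simpa using hij)
    have e : ![E - D, F - D] = ((fun i : {x : Fin 3 // x ≠ 0} => ![D, E, F] ↑i -ᵥ ![D, E, F] 0) ∘
        (fun i : Fin 2 => (⟨i.succ, Fin.succ_ne_zero i⟩ : {x : Fin 3 // x ≠ 0}))) := by
      ext i j; fin_cases i <;> simp
    rw [e]; exact this
  have hN : (E - D) ⨯₃ (F - D) ≠ 0 := crossProduct_ne_zero_iff_linearIndependent.2 hl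
  set N := (E - D) ⨯₃ (F - D) with hNd
  have hm : N ⬝ᵥ N ≠ 0 := by simpa [dotProduct_self_eq_zero] using hN
  set m := N ⬝ᵥ N with hmd
  set nv : Pt := (1 / m) • ((F - D) ⨯₃ N) with hnv
  set nw : Pt := (1 / m) • (N ⨯₃ (E - D)) with hnw
  have key1 : ((F - D) ⨯₃ N) ⬝ᵥ (E - D) = m := by
    simp only [hmd, hNd, cross_apply, dotProduct, Fin.sum_univ_three, Pi.sub_apply]; simp; ring
  have key2 : ((F - D) ⨯₃ N) ⬝ᵥ (F - D) = 0 := by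
    simp only [hNd, cross_apply, dotProduct, Fin.sum_univ_three, Pi.sub_apply]; simp; ring
  have key3 : (N ⨯₃ (E - D)) ⬝ᵥ (E - D) = 0 := by
    simp only [hNd, cross_apply, dotProduct, Fin.sum_univ_three, Pi.sub_apply]; simp; ring
  have key4 : (N ⨯₃ (E - D)) ⬝ᵥ (F - D) = m := by
    simp only [hmd, hNd, cross_apply, dotProduct, Fin.sum_univ_three, Pi.sub_apply]; simp; ring
  have key5 : N ⬝ᵥ (E - D) = 0 := by
    simp only [hNd, cross_apply, dotProduct, Fin.sum_univ_three, Pi.sub_apply]; simp; ring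
  have key6 : N ⬝ᵥ (F - D) = 0 := by
    simp only [hNd, cross_apply, dotProduct, Fin.sum_univ_three, Pi.sub_apply]; simp; ring
  have key7 : ∀ y : Pt, m • y = (N ⬝ᵥ y) • N + (((F - D) ⨯₃ N) ⬝ᵥ y) • (E - D)
      + ((N ⨯₃ (E - D)) ⬝ᵥ y) • (F - D) := by
    intro y
    ext i
    simp only [hmd, hNd, cross_apply, dotProduct, Fin.sum_univ_three, Pi.sub_apply, Pi.add_apply, Pi.smul_apply, smul_eq_mul]
    fin_cases i <;> simp <;> ring
  have e1 : nv ⬝ᵥ (E - D) = 1 := by rw [hnv, smul_dotProduct, key1]; simp [hm]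
  have e2 : nv ⬝ᵥ (F - D) = 0 := by rw [hnv, smul_dotProduct, key2]; simp [hm]
  have e3 : nw ⬝ᵥ (E - D) = 0 := by rw [hnw, smul_dotProduct, key3]; simp [hm]
  have e4 : nw ⬝ᵥ (F - D) = 1 := by rw [hnw, smul_dotProduct, key4]; simp [hm]
  have e7 : ∀ y : Pt, N ⬝ᵥ y = 0 → y = (nv ⬝ᵥ y) • (E - D) + (nw ⬝ᵥ y) • (F - D) := by
    intro y hy
    have := key7 y
    rw [hy, zero_smul, zero_add] at this
    have h3 : y = (1 / m) • (m • y) := by rw [smul_smul]; field_simp; simp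
    rw [this] at h3
    rw [hnv, hnw, smul_dotProduct, smul_dotProduct, smul_eq_mul, smul_eq_mul]
    simpa [smul_smul] using h3
  clear_value nv nw m N
  rw [dotProduct_sub] at e1 e2 e3 e4 key5 key6
  refine ⟨fun p => (-nv - nw) ⬝ᵥ p + (1 + nv ⬝ᵥ D + nw ⬝ᵥ D), fun p => nv ⬝ᵥ p + (-(nv ⬝ᵥ D)),
    fun p => nw ⬝ᵥ p + (-(nw ⬝ᵥ D)), fun p => N ⬝ᵥ p + (-(N ⬝ᵥ D)), isAff_of _ _, isAff_of _ _,
    isAff_of _ _, isAff_of _ _, ?_, ?_, ?_, ?_, ?_, ?_⟩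
  · simp only [sub_dotProduct, neg_dotProduct]; refine ⟨?_, ?_, ?_⟩ <;> linarith
  · refine ⟨?_, ?_, ?_⟩ <;> linarith
  · refine ⟨?_, ?_, ?_⟩ <;> linarith
  · refine ⟨?_, ?_, ?_⟩ <;> linarith
  · intro p; simp only [sub_dotProduct, neg_dotProduct]; ring
  · intro p hp
    have := e7 (p - D) (by rw [dotProduct_sub]; linarith)
    rw [dotProduct_sub, dotProduct_sub] at this
    simp only [sub_dotProduct, neg_dotProduct]
    ext i
    have := congrFun this i
    simp only [Pi.sub_apply, Pi.add_apply, Pi.smul_apply, smul_eq_mul] at this ⊢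
    linarith

lemma Tri.exists_coord (T : Tri) :
    ∃ u v w z : Pt → ℝ, IsAff u ∧ IsAff v ∧ IsAff w ∧ IsAff z ∧
      (∀ p, u p + v p + w p = 1) ∧
      (∀ p, z p = 0 → p = u p • T.A + v p • T.B + w p • T.C) ∧
      (∀ p, p ∈ T.hull ↔ z p = 0 ∧ 0 ≤ u p ∧ 0 ≤ v p ∧ 0 ≤ w p) ∧
      (∀ p, p ∈ T.outline ↔ z p = 0 ∧ 0 ≤ u p ∧ 0 ≤ v p ∧ 0 ≤ w p ∧ u p * v p * w p = 0) := by
  obtain ⟨u, v, w, z, hu, hv, hw, hz, ⟨u1, u2, u3⟩, ⟨v1, v2, v3⟩, ⟨w1, w2, w3⟩, ⟨z1, z2, z3⟩, hs, hr⟩ :=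
    _root_.exists_coord T.A T.B T.C T.indep
  have comb : ∀ a b c : ℝ, a + b + c = 1 →
      u (a • T.A + b • T.B + c • T.C) = a ∧ v (a • T.A + b • T.B + c • T.C) = b ∧
      w (a • T.A + b • T.B + c • T.C) = c ∧ z (a • T.A + b • T.B + c • T.C) = 0 := by
    intro a b c h
    rw [hu _ _ _ _ _ _ h, hv _ _ _ _ _ _ h, hw _ _ _ _ _ _ h, hz _ _ _ _ _ _ h]
    simp [u1, u2, u3, v1, v2, v3, w1, w2, w3, z1, z2, z3]
  refine ⟨u, v, w, z, hu, hv, hw, hz, hs, hr, ?_, ?_⟩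
  · intro p
    rw [Tri.hull, mem_hull3]
    constructor
    · rintro ⟨a, b, c, ha, hb, hc, h, rfl⟩
      obtain ⟨h1, h2, h3, h4⟩ := comb a b c h
      rw [h1, h2, h3, h4]; exact ⟨rfl, ha, hb, hc⟩
    · rintro ⟨h0, ha, hb, hc⟩
      exact ⟨_, _, _, ha, hb, hc, hs p, hr p h0⟩
  · intro p
    constructor
    · rintro ((⟨a, b, ha, hb, h, hp⟩ | ⟨a, b, ha, hb, h, hp⟩) | ⟨a, b, ha, hb, h, hp⟩)
      · obtain ⟨h1, h2, h3, h4⟩ := comb a b 0 (by linarith)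
        rw [zero_smul, add_zero, hp] at h1 h2 h3 h4
        rw [h1, h2, h3, h4]; simp [ha, hb]
      · obtain ⟨h1, h2, h3, h4⟩ := comb 0 a b (by linarith)
        rw [zero_smul, zero_add, hp] at h1 h2 h3 h4
        rw [h1, h2, h3, h4]; simp [ha, hb]
      · obtain ⟨h1, h2, h3, h4⟩ := comb b 0 a (by linarith)
        rw [zero_smul, add_zero, add_comm, hp] at h1 h2 h3 h4
        rw [h1, h2, h3, h4]; simp [ha, hb]
    · rintro ⟨h0, ha, hb, hc, h⟩
      have e := hr p h0
      have s := hs p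
      rcases mul_eq_zero.1 h with h | h
      · rcases mul_eq_zero.1 h with h | h
        · left; right
          refine ⟨v p, w p, hb, hc, by linarith, ?_⟩
          rw [h, zero_smul, zero_add] at e; exact e.symm
        · right
          refine ⟨w p, u p, hc, ha, by linarith, ?_⟩
          rw [h, zero_smul, add_zero, add_comm] at e; exact e.symm
      · left; left
        refine ⟨u p, v p, ha, hb, by linarith, ?_⟩
        rw [h, zero_smul, add_zero] at e; exact e.symm

lemma small_step (m n : ℝ) (hm : 0 < m) :
    ∃ δ : ℝ, 0 < δ ∧ δ ≤ 1 ∧ ∀ s, s ≤ δ → 0 ≤ s → 0 ≤ (1 - s) * m + s * n := by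
  have hp : 0 < m + |n| := by positivity
  refine ⟨m / (m + |n|), by positivity, ?_, ?_⟩
  · rw [div_le_one hp]; linarith [abs_nonneg n]
  · intro s hs h0
    rw [le_div_iff₀ hp] at hs
    nlinarith [neg_abs_le n]

lemma no_flat (T : Tri) (S : Set Pt) (P Q U V : Pt) (hP : P ∈ segment ℝ U V) (hUV : U ≠ V)
    (hS : segment ℝ U V ⊆ S) (hPQ : S ∩ T.hull = {P, Q})
    (u v w z : Pt → ℝ) (hu : IsAff u) (hv : IsAff v) (hw : IsAff w) (hz : IsAff z)
    (hh : ∀ p, p ∈ T.hull ↔ z p = 0 ∧ 0 ≤ u p ∧ 0 ≤ v p ∧ 0 ≤ w p)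
    (zP : z P = 0) (zU : z U = 0) (zV : z V = 0)
    (uP : 0 < u P) (vP : 0 < v P) (wP : 0 < w P) : False := by
  obtain ⟨R, hR, zR, hne⟩ : ∃ R, R ∈ segment ℝ U V ∧ z R = 0 ∧ P ≠ R := by
    by_cases h : P = U
    · exact ⟨V, right_mem_segment _ _ _, zV, h ▸ hUV⟩
    · exact ⟨U, left_mem_segment _ _ _, zU, h⟩
  obtain ⟨d1, p1, q1, f1⟩ := small_step (u P) (u R) uP
  obtain ⟨d2, p2, q2, f2⟩ := small_step (v P) (v R) vP
  obtain ⟨d3, p3, q3, f3⟩ := small_step (w P) (w R) wP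
  have inj : ∀ s t : ℝ, (1 - s) • P + s • R = (1 - t) • P + t • R → s = t := by
    intro s t h
    by_contra hst
    apply hne
    have h1 : (s - t) • (P - R) = 0 := by
      have : (s - t) • (P - R) = ((1 - t) • P + t • R) - ((1 - s) • P + s • R) := by module
      rw [this, h, sub_self]
    rcases smul_eq_zero.1 h1 with h2 | h2
    · exact absurd (sub_eq_zero.1 h2) hst
    · exact sub_eq_zero.1 h2
  have mem : ∀ s : ℝ, 0 < s → s ≤ min d1 (min d2 d3) → (1 - s) • P + s • R = Q := by
    intro s h0 hs
    simp only [le_min_iff] at hs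
    have : (1 - s) • P + s • R ∈ S ∩ T.hull := by
      refine ⟨hS ((convex_segment U V) hP hR (by linarith) h0.le (by ring)), ?_⟩
      rw [hh, hu.line, hv.line, hw.line, hz.line, zP, zR]
      exact ⟨by ring, f1 s hs.1 h0.le, f2 s hs.2.1 h0.le, f3 s hs.2.2 h0.le⟩
    rw [hPQ] at this
    rcases this with h | h
    · have := inj s 0 (by rw [h]; simp)
      linarith
    · exact h
  have hd : 0 < min d1 (min d2 d3) := lt_min p1 (lt_min p2 p3)
  have a1 := mem _ hd le_rfl
  have a2 := mem (min d1 (min d2 d3) / 2) (by linarith) (by linarith)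
  have := inj _ _ (a1.trans a2.symm)
  linarith

/-- Two vectors orthogonal to `(1,1,1)` and to `z` not parallel to it are parallel. -/
lemma par (z1 z2 z3 a1 a2 a3 b1 b2 b3 : ℝ) (ha : a1 + a2 + a3 = 0) (hb : b1 + b2 + b3 = 0)
    (hza : a1 * z1 + a2 * z2 + a3 * z3 = 0) (hzb : b1 * z1 + b2 * z2 + b3 * z3 = 0)
    (hz : ¬ (z1 = z2 ∧ z2 = z3)) (hb0 : ¬ (b1 = 0 ∧ b2 = 0 ∧ b3 = 0)) :
    ∃ t, a1 = t * b1 ∧ a2 = t * b2 ∧ a3 = t * b3 := by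
  have hc : a1 * b2 - a2 * b1 = 0 := by
    by_contra hc
    apply hz
    have h1 : (a1 * b2 - a2 * b1) * (z1 - z3) = 0 := by
      linear_combination b2 * hza - a2 * hzb - b2 * z3 * ha + a2 * z3 * hb
    have h2 : (a1 * b2 - a2 * b1) * (z2 - z3) = 0 := by
      linear_combination - b1 * hza + a1 * hzb + b1 * z3 * ha - a1 * z3 * hb
    have h1' := (mul_eq_zero.1 h1).resolve_left hc
    have h2' := (mul_eq_zero.1 h2).resolve_left hc
    constructor <;> linarith
  by_cases h1 : b1 = 0
  · have h2 : b2 ≠ 0 := by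
      intro h2; exact hb0 ⟨h1, h2, by linarith⟩
    have e1 : a1 = 0 := by
      rw [h1, mul_zero, sub_zero] at hc; exact (mul_eq_zero.1 hc).resolve_right h2
    have e2 : a2 = a2 / b2 * b2 := by field_simp
    refine ⟨a2 / b2, by rw [e1, h1, mul_zero], e2, ?_⟩
    linear_combination ha - e2 - e1 - (a2 / b2) * hb + (a2 / b2) * h1
  · have e1 : a1 = a1 / b1 * b1 := by field_simp
    have e2 : a2 = a1 / b1 * b2 := by field_simp; linarith
    refine ⟨a1 / b1, e1, e2, ?_⟩
    linear_combination ha - e2 - e1 - (a1 / b1) * hb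

/-- If `∂Λ1 ∩ ⟨Λ2⟩` consists of exactly two points, then `∂Λ2 ∩ ⟨Λ1⟩ = ∅`. -/
theorem stmt13 (Λ1 Λ2 : Tri) (h : Disjoint Λ1.outline Λ2.outline)
    (h2 : ∃ P Q : Pt, P ≠ Q ∧ Λ1.outline ∩ Λ2.hull = {P, Q}) :
    Λ2.outline ∩ Λ1.hull = ∅ := by
  obtain ⟨P, Q, hne, hPQ⟩ := h2
  rw [Set.eq_empty_iff_forall_notMem]
  rintro X ⟨X2, X1⟩
  have hdis : ∀ p, p ∈ Λ1.outline → p ∈ Λ2.outline → False :=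
    fun p h1 h2 => Set.disjoint_left.1 h h1 h2
  have hPm : P ∈ Λ1.outline ∩ Λ2.hull := by rw [hPQ]; simp
  have hQm : Q ∈ Λ1.outline ∩ Λ2.hull := by rw [hPQ]; simp
  obtain ⟨P1, P2⟩ := hPm
  obtain ⟨Q1, Q2⟩ := hQm
  have nP := hdis P P1
  have nQ := hdis Q Q1
  have nX : X ∉ Λ1.outline := fun hx => hdis X hx X2
  obtain ⟨u, v, w, z, hu, hv, hw, hz, hs, hr, hh, ho⟩ := Λ2.exists_coord
  obtain ⟨u', v', w', z', hu', hv', hw', hz', hs', hr', hh', ho'⟩ := Λ1.exists_coord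
  have pos : ∀ a b c : ℝ, 0 ≤ a → 0 ≤ b → 0 ≤ c → a * b * c ≠ 0 → 0 < a ∧ 0 < b ∧ 0 < c := by
    intro a b c ha hb hc hn
    refine ⟨lt_of_le_of_ne ha ?_, lt_of_le_of_ne hb ?_, lt_of_le_of_ne hc ?_⟩ <;>
      (rintro rfl; simp at hn)
  have inn : ∀ p, p ∈ Λ2.hull → ¬ (p ∈ Λ2.outline) → z p = 0 ∧ 0 < u p ∧ 0 < v p ∧ 0 < w p := by
    intro p hp hn
    obtain ⟨h0, h1, h2, h3⟩ := (hh p).1 hp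
    exact ⟨h0, pos _ _ _ h1 h2 h3 fun hh => hn ((ho p).2 ⟨h0, h1, h2, h3, hh⟩)⟩
  obtain ⟨zP, uP, vP, wP⟩ := inn P P2 nP
  obtain ⟨zQ, uQ, vQ, wQ⟩ := inn Q Q2 nQ
  obtain ⟨zX, -, -, -, pX⟩ := (ho X).1 X2
  obtain ⟨z'X, x1, x2, x3⟩ := (hh' X).1 X1
  obtain ⟨x1, x2, x3⟩ := pos _ _ _ x1 x2 x3 fun hh => nX ((ho' X).2 ⟨z'X, x1, x2, x3, hh⟩)
  obtain ⟨z'P, p1, p2, p3, pP⟩ := (ho' P).1 P1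
  obtain ⟨z'Q, q1, q2, q3, pQ⟩ := (ho' Q).1 Q1
  have rX := hr' X z'X
  have rP := hr' P z'P
  have rQ := hr' Q z'Q
  have zz : ∀ p, z' p = 0 → z p = u' p * z Λ1.A + v' p * z Λ1.B + w' p * z Λ1.C := by
    intro p hp
    conv_lhs => rw [hr' p hp]
    exact hz _ _ _ _ _ _ (hs' p)
  have zzP := zz P z'P
  have zzQ := zz Q z'Q
  have zzX := zz X z'X
  rw [zP] at zzP
  rw [zQ] at zzQ
  rw [zX] at zzX
  by_cases hflat : z Λ1.A = z Λ1.B ∧ z Λ1.B = z Λ1.C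
  · obtain ⟨f1, f2⟩ := hflat
    have sP := hs' P
    have fC : z Λ1.C = 0 := by
      rw [f1, f2] at zzP; linear_combination (-z Λ1.C) * sP - zzP
    have fB : z Λ1.B = 0 := f2.trans fC
    have fA : z Λ1.A = 0 := f1.trans fB
    have hi := Λ1.indep.injective
    have nAB : Λ1.A ≠ Λ1.B := fun e => by simpa using hi.ne (show (0 : Fin 3) ≠ 1 by decide) e
    have nBC : Λ1.B ≠ Λ1.C := fun e => by simpa using hi.ne (show (1 : Fin 3) ≠ 2 by decide) e
    have nCA : Λ1.C ≠ Λ1.A := fun e => by simpa using hi.ne (show (2 : Fin 3) ≠ 0 by decide) e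
    rcases P1 with (P1 | P1) | P1
    · exact no_flat Λ2 _ P Q _ _ P1 nAB (fun x hx => Or.inl (Or.inl hx)) hPQ u v w z hu hv hw hz hh
        zP fA fB uP vP wP
    · exact no_flat Λ2 _ P Q _ _ P1 nBC (fun x hx => Or.inl (Or.inr hx)) hPQ u v w z hu hv hw hz hh
        zP fB fC uP vP wP
    · exact no_flat Λ2 _ P Q _ _ P1 nCA (fun x hx => Or.inr hx) hPQ u v w z hu hv hw hz hh
        zP fC fA uP vP wP
  · have sP := hs' P
    have sQ := hs' Q
    have sX := hs' X
    obtain ⟨t, t1, t2, t3⟩ := par (z Λ1.A) (z Λ1.B) (z Λ1.C)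
      (u' X - u' P) (v' X - v' P) (w' X - w' P) (u' Q - u' P) (v' Q - v' P) (w' Q - w' P)
      (by linarith) (by linarith) (by linarith) (by linarith) hflat (by
        rintro ⟨h1, h2, h3⟩
        apply hne
        rw [rP, rQ, sub_eq_zero.1 h1, sub_eq_zero.1 h2, sub_eq_zero.1 h3])
    have ht0 : 0 ≤ t := by
      by_contra! ht
      have aux : ∀ x p q : ℝ, 0 < x → 0 ≤ q → x - p = t * (q - p) → 0 < p := by
        intro x p q hx hq he
        by_contra! hp
        nlinarith
      have a1 := aux _ _ _ x1 q1 t1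
      have a2 := aux _ _ _ x2 q2 t2
      have a3 := aux _ _ _ x3 q3 t3
      have : 0 < u' P * v' P * w' P := by positivity
      linarith
    have ht1 : t ≤ 1 := by
      by_contra! ht
      have aux : ∀ x p q : ℝ, 0 < x → 0 ≤ p → x - p = t * (q - p) → 0 < q := by
        intro x p q hx hp he
        by_contra! hq
        nlinarith
      have a1 := aux _ _ _ x1 p1 t1
      have a2 := aux _ _ _ x2 p2 t2
      have a3 := aux _ _ _ x3 p3 t3
      have : 0 < u' Q * v' Q * w' Q := by positivity
      linarith
    have hX : X = (1 - t) • P + t • Q := by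
      have e1 : u' X = (1 - t) * u' P + t * u' Q := by linarith
      have e2 : v' X = (1 - t) * v' P + t * v' Q := by linarith
      have e3 : w' X = (1 - t) * w' P + t * w' Q := by linarith
      rw [rX, e1, e2, e3]
      conv_rhs => rw [rP, rQ]
      module
    have cpos : ∀ a b : ℝ, 0 < a → 0 < b → 0 < (1 - t) * a + t * b := by
      intro a b ha hb
      rcases ht0.eq_or_lt with h0 | h0
      · rw [← h0]; simpa using ha
      · have : 0 ≤ (1 - t) * a := mul_nonneg (by linarith) ha.le
        have : 0 < t * b := by positivity
        linarith
    rw [hX, hu.line, hv.line, hw.line] at pX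
    have := mul_pos (mul_pos (cpos _ _ uP uQ) (cpos _ _ vP vQ)) (cpos _ _ wP wQ)
    linarith
end
end

section
/- Let Λ1 and Λ2 be triangles in ℝ³ with disjoint outlines such that ∂Λ1 ∩ ⟨Λ2⟩ = {P, Q} with P ≠ Q. Then ⟨Λ1⟩ ∩ ⟨Λ2⟩ equals the closed segment [P, Q]. -/
open scoped Matrix

noncomputable section

theorem hull_mem (T : Tri) (x : Pt) : x ∈ T.hull ↔ ∃ a b c : ℝ, 0 ≤ a ∧ 0 ≤ b ∧ 0 ≤ c ∧
    a + b + c = 1 ∧ x = a • T.A + b • T.B + c • T.C := by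
  unfold Tri.hull
  constructor
  · intro hx
    rw [convexHull_insert (by simp), convexHull_pair] at hx
    simp only [convexJoin_singleton_left, Set.mem_iUnion] at hx
    obtain ⟨y, ⟨a, b, ha, hb, hab, rfl⟩, ⟨c, d, hc, hd, hcd, rfl⟩⟩ := hx
    refine ⟨c, d * a, d * b, hc, by positivity, by positivity, ?_, by module⟩
    rw [add_assoc, ← mul_add, hab, mul_one, hcd]
  · rintro ⟨a, b, c, ha, hb, hc, hs, rfl⟩
    have hA : T.A ∈ convexHull ℝ {T.A, T.B, T.C} := subset_convexHull _ _ (by simp)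
    have hB : T.B ∈ convexHull ℝ {T.A, T.B, T.C} := subset_convexHull _ _ (by simp)
    have hC : T.C ∈ convexHull ℝ {T.A, T.B, T.C} := subset_convexHull _ _ (by simp)
    have := (convex_convexHull ℝ {T.A, T.B, T.C}).sum_mem (t := Finset.univ)
      (w := ![a, b, c]) (z := ![T.A, T.B, T.C])
      (by intro i _; fin_cases i <;> simpa) (by simp [Fin.sum_univ_three, hs])
      (by intro i _; fin_cases i <;> simpa)
    simpa [Fin.sum_univ_three] using this

theorem outline_mem (T : Tri) (x : Pt) : x ∈ T.outline ↔ ∃ a b c : ℝ, 0 ≤ a ∧ 0 ≤ b ∧ 0 ≤ c ∧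
    a + b + c = 1 ∧ x = a • T.A + b • T.B + c • T.C ∧ (a = 0 ∨ b = 0 ∨ c = 0) := by
  unfold Tri.outline
  constructor
  · rintro ((⟨a, b, ha, hb, hab, rfl⟩ | ⟨a, b, ha, hb, hab, rfl⟩) | ⟨a, b, ha, hb, hab, rfl⟩)
    · exact ⟨a, b, 0, ha, hb, le_rfl, by linarith, by module, by simp⟩
    · exact ⟨0, a, b, le_rfl, ha, hb, by linarith, by module, by simp⟩
    · exact ⟨b, 0, a, hb, le_rfl, ha, by linarith, by module, by simp⟩
  · rintro ⟨a, b, c, ha, hb, hc, hs, rfl, rfl | rfl | rfl⟩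
    · exact Or.inl (Or.inr ⟨b, c, hb, hc, by linarith, by module⟩)
    · exact Or.inr ⟨c, a, hc, ha, by linarith, by module⟩
    · exact Or.inl (Or.inl ⟨a, b, ha, hb, by linarith, by module⟩)

theorem indep_zero (T : Tri) (a b c : ℝ) (hs : a + b + c = 0)
    (h : a • T.A + b • T.B + c • T.C = 0) : a = 0 ∧ b = 0 ∧ c = 0 := by
  have := affineIndependent_iff.1 T.indep Finset.univ ![a, b, c]
    (by simp [Fin.sum_univ_three, hs]) (by simpa [Fin.sum_univ_three] using h)
  exact ⟨by simpa using this 0 (by simp), by simpa using this 1 (by simp),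
    by simpa using this 2 (by simp)⟩

theorem small_pos (p w : ℝ) (hp : 0 < p) : ∃ ε > 0, ∀ t, 0 ≤ t → t ≤ ε → 0 ≤ p + t * w := by
  refine ⟨p / (|w| + 1), by positivity, fun t h0 ht => ?_⟩
  rw [le_div_iff₀ (by positivity)] at ht
  have := neg_abs_le w
  nlinarith

theorem edge_dir (a b c : ℝ) (ha : 0 ≤ a) (hb : 0 ≤ b) (hc : 0 ≤ c) (hs : a + b + c = 1)
    (h : a = 0 ∨ b = 0 ∨ c = 0) : ∃ u v w : ℝ, u + v + w = 0 ∧ ¬ (u = 0 ∧ v = 0 ∧ w = 0) ∧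
    ∃ ε > 0, ∀ t, 0 ≤ t → t ≤ ε → 0 ≤ a + t * u ∧ 0 ≤ b + t * v ∧ 0 ≤ c + t * w ∧
      (a + t * u = 0 ∨ b + t * v = 0 ∨ c + t * w = 0) := by
  rcases h with rfl | rfl | rfl
  · rcases hb.eq_or_lt with rfl | hb
    · exact ⟨0, 1, -1, by norm_num, by norm_num, 1, one_pos, fun t h0 h1 =>
        ⟨by linarith, by linarith, by linarith, by simp⟩⟩
    · exact ⟨0, -1, 1, by norm_num, by norm_num, b, hb, fun t h0 h1 =>
        ⟨by linarith, by linarith, by linarith, by simp⟩⟩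
  · rcases ha.eq_or_lt with rfl | ha
    · exact ⟨1, 0, -1, by norm_num, by norm_num, 1, one_pos, fun t h0 h1 =>
        ⟨by linarith, by linarith, by linarith, by simp⟩⟩
    · exact ⟨-1, 0, 1, by norm_num, by norm_num, a, ha, fun t h0 h1 =>
        ⟨by linarith, by linarith, by linarith, by simp⟩⟩
  · rcases ha.eq_or_lt with rfl | ha
    · exact ⟨1, -1, 0, by norm_num, by norm_num, 1, one_pos, fun t h0 h1 =>
        ⟨by linarith, by linarith, by linarith, by simp⟩⟩
    · exact ⟨-1, 1, 0, by norm_num, by norm_num, a, ha, fun t h0 h1 =>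
        ⟨by linarith, by linarith, by linarith, by simp⟩⟩

theorem zero_aux (x p q s : ℝ) (hx : 0 ≤ x) (hq : 0 ≤ q) (hp : p = 0) (hs : s < 0)
    (e : x = p + s * (q - p)) : x = 0 := by
  subst hp
  nlinarith

/-- If `P` lies strictly between `X` and `Q`, with `P` on the outline, so does `X`. -/
theorem beyond (T : Tri) (x1 x2 x3 p1 p2 p3 q1 q2 q3 s : ℝ)
    (hx1 : 0 ≤ x1) (hx2 : 0 ≤ x2) (hx3 : 0 ≤ x3) (hx : x1 + x2 + x3 = 1)
    (hq1 : 0 ≤ q1) (hq2 : 0 ≤ q2) (hq3 : 0 ≤ q3)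
    (hp : p1 = 0 ∨ p2 = 0 ∨ p3 = 0) (hs : s < 0)
    (e1 : x1 = p1 + s * (q1 - p1)) (e2 : x2 = p2 + s * (q2 - p2))
    (e3 : x3 = p3 + s * (q3 - p3)) :
    x1 • T.A + x2 • T.B + x3 • T.C ∈ T.outline := by
  rw [outline_mem]
  refine ⟨x1, x2, x3, hx1, hx2, hx3, hx, rfl, ?_⟩
  rcases hp with h | h | h
  · exact Or.inl (zero_aux _ _ _ _ hx1 hq1 h hs e1)
  · exact Or.inr (Or.inl (zero_aux _ _ _ _ hx2 hq2 h hs e2))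
  · exact Or.inr (Or.inr (zero_aux _ _ _ _ hx3 hq3 h hs e3))

/-- If `∂Λ1 ∩ ⟨Λ2⟩ = {P, Q}` with `P ≠ Q`, then `⟨Λ1⟩ ∩ ⟨Λ2⟩` is the segment `[P, Q]`. -/
theorem stmt14 (Λ1 Λ2 : Tri) (h : Disjoint Λ1.outline Λ2.outline)
    (P Q : Pt) (hPQ : P ≠ Q) (h2 : Λ1.outline ∩ Λ2.hull = {P, Q}) :
    Λ1.hull ∩ Λ2.hull = segment ℝ P Q := by
  have hP := h2.ge (Set.mem_insert P {Q})
  have hQ := h2.ge (Set.mem_insert_of_mem P (Set.mem_singleton Q))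
  have hsub : ∀ y, y ∈ Λ1.outline → y ∈ Λ2.hull → y = P ∨ y = Q := fun y h1 h3 =>
    h2.le ⟨h1, h3⟩
  have hPn : P ∉ Λ2.outline := fun h' => Set.disjoint_left.1 h hP.1 h'
  obtain ⟨hP1, hP2⟩ := hP
  obtain ⟨hQ1, hQ2⟩ := hQ
  obtain ⟨p1, p2, p3, hp1, hp2, hp3, hp, eP, hpz⟩ := (outline_mem _ _).1 hP1
  obtain ⟨q1, q2, q3, hq1, hq2, hq3, hq, eQ, hqz⟩ := (outline_mem _ _).1 hQ1
  have hPh : P ∈ Λ1.hull := (hull_mem _ _).2 ⟨p1, p2, p3, hp1, hp2, hp3, hp, eP⟩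
  have hQh : Q ∈ Λ1.hull := (hull_mem _ _).2 ⟨q1, q2, q3, hq1, hq2, hq3, hq, eQ⟩
  apply Set.Subset.antisymm
  swap
  · exact Set.subset_inter ((convex_convexHull ℝ _).segment_subset hPh hQh)
      ((convex_convexHull ℝ _).segment_subset hP2 hQ2)
  rintro X ⟨hX1, hX2⟩
  by_contra hX
  have hXn : X ∉ Λ1.outline := by
    intro hXo
    rcases hsub X hXo hX2 with rfl | rfl
    · exact hX (left_mem_segment ℝ _ _)
    · exact hX (right_mem_segment ℝ _ _)
  obtain ⟨x1, x2, x3, hx1, hx2, hx3, hx, eX⟩ := (hull_mem _ _).1 hX1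
  have hcol : ∀ s : ℝ, x2 = p2 + s * (q2 - p2) → x3 = p3 + s * (q3 - p3) → False := by
    intro s e2 e3
    have e1 : x1 = p1 + s * (q1 - p1) := by
      have h1 : x1 = 1 - x2 - x3 := by linarith
      have h2 : p1 = 1 - p2 - p3 := by linarith
      have h3 : q1 = 1 - q2 - q3 := by linarith
      rw [h1, h2, h3, e2, e3]; ring
    rcases lt_or_ge s 0 with hs | hs
    · exact hXn (eX ▸ beyond Λ1 x1 x2 x3 p1 p2 p3 q1 q2 q3 s hx1 hx2 hx3 hx hq1 hq2 hq3 hpz hs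
        e1 e2 e3)
    rcases lt_or_ge 1 s with hs' | hs'
    · exact hXn (eX ▸ beyond Λ1 x1 x2 x3 q1 q2 q3 p1 p2 p3 (1 - s) hx1 hx2 hx3 hx hp1 hp2 hp3 hqz
        (by linarith) (by rw [e1]; ring) (by rw [e2]; ring) (by rw [e3]; ring))
    · refine hX ⟨1 - s, s, by linarith, hs, by ring, ?_⟩
      rw [eX, eP, eQ, e1, e2, e3]
      module
  by_cases hD : (x2 - p2) * (q3 - p3) - (x3 - p3) * (q2 - p2) = 0
  · by_cases h20 : q2 - p2 = 0
    · by_cases h30 : q3 - p3 = 0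
      · apply hPQ
        have a1 : q1 = p1 := by linarith
        have a2 : q2 = p2 := by linarith
        have a3 : q3 = p3 := by linarith
        rw [eP, eQ, a1, a2, a3]
      · refine hcol ((x3 - p3) / (q3 - p3)) ?_ ?_
        · field_simp
          linarith
        · field_simp
          ring
    · refine hcol ((x2 - p2) / (q2 - p2)) ?_ ?_
      · field_simp
        ring
      · field_simp
        linarith
  -- coplanar case
  obtain ⟨u, v, w, huvw, hne, ε, hε, hmv⟩ := edge_dir p1 p2 p3 hp1 hp2 hp3 hp hpz
  obtain ⟨a, b, hav, haw⟩ : ∃ a b : ℝ, v = a * (x2 - p2) + b * (q2 - p2) ∧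
      w = a * (x3 - p3) + b * (q3 - p3) := by
    refine ⟨(v * (q3 - p3) - w * (q2 - p2)) / ((x2 - p2) * (q3 - p3) - (x3 - p3) * (q2 - p2)),
      ((x2 - p2) * w - (x3 - p3) * v) / ((x2 - p2) * (q3 - p3) - (x3 - p3) * (q2 - p2)), ?_, ?_⟩
    · rw [div_mul_eq_mul_div, div_mul_eq_mul_div, ← add_div, eq_div_iff hD]; ring
    · rw [div_mul_eq_mul_div, div_mul_eq_mul_div, ← add_div, eq_div_iff hD]; ring
  have hau : u = a * (x1 - p1) + b * (q1 - p1) := by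
    have h1 : x1 = 1 - x2 - x3 := by linarith
    have h2 : p1 = 1 - p2 - p3 := by linarith
    have h3 : q1 = 1 - q2 - q3 := by linarith
    have h4 : u = - v - w := by linarith
    rw [h1, h2, h3, h4, hav, haw]; ring
  set W : Pt := u • Λ1.A + v • Λ1.B + w • Λ1.C with hW
  have hW0 : W ≠ 0 := fun h0 => hne (indep_zero Λ1 u v w huvw h0)
  have hWe : W = a • (X - P) + b • (Q - P) := by
    rw [hW, eX, eP, eQ, hau, hav, haw]; module
  obtain ⟨k1, k2, k3, hk1, hk2, hk3, hk, fP⟩ := (hull_mem _ _).1 hP2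
  obtain ⟨l1, l2, l3, -, -, -, hl, fQ⟩ := (hull_mem _ _).1 hQ2
  obtain ⟨m1, m2, m3, -, -, -, hm, fX⟩ := (hull_mem _ _).1 hX2
  have hpos : 0 < k1 ∧ 0 < k2 ∧ 0 < k3 := by
    refine ⟨hk1.lt_of_ne' fun h0 => ?_, hk2.lt_of_ne' fun h0 => ?_, hk3.lt_of_ne' fun h0 => ?_⟩ <;>
    exact hPn ((outline_mem _ _).2 ⟨k1, k2, k3, hk1, hk2, hk3, hk, fP, by simp [h0]⟩)
  obtain ⟨ε1, hε1, g1⟩ := small_pos k1 (a * (m1 - k1) + b * (l1 - k1)) hpos.1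
  obtain ⟨ε2, hε2, g2⟩ := small_pos k2 (a * (m2 - k2) + b * (l2 - k2)) hpos.2.1
  obtain ⟨ε3, hε3, g3⟩ := small_pos k3 (a * (m3 - k3) + b * (l3 - k3)) hpos.2.2
  obtain ⟨δ, hδ, d0, d1, d2, d3⟩ : ∃ δ > 0, δ ≤ ε ∧ δ ≤ ε1 ∧ δ ≤ ε2 ∧ δ ≤ ε3 :=
    ⟨min (min ε ε1) (min ε2 ε3), by positivity, by simp, by simp, by simp, by simp⟩
  have key : ∀ t, 0 < t → t ≤ δ → P + t • W = Q := by
    intro t ht htd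
    have hin : P + t • W = P ∨ P + t • W = Q := by
      apply hsub
      · obtain ⟨r1, r2, r3, r4⟩ := hmv t ht.le (htd.trans d0)
        refine (outline_mem _ _).2 ⟨_, _, _, r1, r2, r3, ?_, ?_, r4⟩
        · linear_combination hp + t * huvw
        · rw [hW, eP]; module
      · refine (hull_mem _ _).2 ⟨_, _, _, g1 t ht.le (htd.trans d1), g2 t ht.le (htd.trans d2),
          g3 t ht.le (htd.trans d3), ?_, ?_⟩
        · linear_combination hk + t * (a * (hm - hk) + b * (hl - hk))
        · rw [hWe, fP, fQ, fX]; module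
    rcases hin with h' | h'
    · simp [ht.ne', hW0] at h'
    · exact h'
  have t1 := key δ hδ le_rfl
  have t2 := key (δ / 2) (by linarith) (by linarith)
  have t3 : (δ / 2) • W = 0 := by
    have t4 : (δ / 2) • W = (P + δ • W) - (P + (δ / 2) • W) := by module
    rw [t4, t1, t2, sub_self]
  rcases smul_eq_zero.1 t3 with h' | h'
  · linarith
  · exact hW0 h'
end
end

section
/- Let Δ0, Δ1, Δ2 be triangles in ℝ³ with pairwise disjoint outlines such that ⟨Δ0⟩ ∩ ⟨Δ1⟩ ∩ ⟨Δ2⟩ ≠ ∅ and for each j ∈ {0,1,2} the set ∂Δj ∩ ⟨Δ_{(j+1) mod 3}⟩ consists of exactly two points. If ∂Δ1 ∩ ⟨Δ2⟩ = {P, Q}, then P and Q lie strictly on opposite sides of the plane affinely spanned by the vertices of Δ0. -/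
open scoped Matrix

noncomputable section

theorem Tri.mem_hull {T : Tri} {X : Pt} : X ∈ T.hull ↔
    ∃ a b c : ℝ, 0 ≤ a ∧ 0 ≤ b ∧ 0 ≤ c ∧ a + b + c = 1 ∧ X = a • T.A + b • T.B + c • T.C := by
  unfold Tri.hull
  rw [convexHull_insert (by simp), convexHull_pair]
  constructor
  · intro h
    rw [mem_convexJoin] at h
    obtain ⟨y, hy, z, hz, u, v, hu, hv, huv, rfl⟩ := h
    obtain rfl := hy
    obtain ⟨s, t, hs, ht, hst, rfl⟩ := hz
    refine ⟨u, v * s, v * t, hu, mul_nonneg hv hs, mul_nonneg hv ht, ?_, ?_⟩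
    · rw [add_assoc, ← mul_add, hst, mul_one, huv]
    · module
  · rintro ⟨a, b, c, ha, hb, hc, habc, rfl⟩
    rw [← convexHull_pair, ← convexHull_insert (by simp)]
    have hA : T.A ∈ convexHull ℝ {T.A, T.B, T.C} := subset_convexHull _ _ (by simp)
    have hB : T.B ∈ convexHull ℝ {T.A, T.B, T.C} := subset_convexHull _ _ (by simp)
    have hC : T.C ∈ convexHull ℝ {T.A, T.B, T.C} := subset_convexHull _ _ (by simp)
    have := (convex_convexHull ℝ {T.A, T.B, T.C}).sum_mem (t := Finset.univ)
      (w := ![a, b, c]) (z := ![T.A, T.B, T.C])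
      (by intro i _; fin_cases i <;> simpa) (by simp [Fin.sum_univ_three, habc])
      (by intro i _; fin_cases i <;> simpa)
    simpa [Fin.sum_univ_three] using this

abbrev Tri.plane (T : Tri) : AffineSubspace ℝ Pt := affineSpan ℝ ({T.A, T.B, T.C} : Set Pt)

theorem Tri.hull_sub_plane (T : Tri) {X : Pt} (h : X ∈ T.hull) : X ∈ T.plane :=
  convexHull_subset_affineSpan _ h

theorem Tri.mem_plane {T : Tri} {X : Pt} (h : X ∈ T.plane) :
    ∃ a b c : ℝ, a + b + c = 1 ∧ X = a • T.A + b • T.B + c • T.C := by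
  have hr : ({T.A, T.B, T.C} : Set Pt) = Set.range ![T.A, T.B, T.C] := by
    simp only [Matrix.range_cons, Matrix.range_empty, Set.union_empty, Set.singleton_union]
  unfold Tri.plane at h
  rw [hr] at h
  obtain ⟨w, hw, rfl⟩ := eq_affineCombination_of_mem_affineSpan_of_fintype h
  rw [Finset.affineCombination_eq_linear_combination _ _ _ hw]
  refine ⟨w 0, w 1, w 2, ?_, ?_⟩
  · rw [← hw, Fin.sum_univ_three]
  · simp [Fin.sum_univ_three]

theorem Tri.uniq (T : Tri) {a b c : ℝ} (h : a + b + c = 0)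
    (h2 : a • T.A + b • T.B + c • T.C = 0) : a = 0 ∧ b = 0 ∧ c = 0 := by
  have := affineIndependent_iff.1 T.indep Finset.univ ![a, b, c]
    (by simpa [Fin.sum_univ_three] using h) (by simpa [Fin.sum_univ_three] using h2)
  exact ⟨by simpa using this 0 (by simp), by simpa using this 1 (by simp),
    by simpa using this 2 (by simp)⟩

theorem Tri.outline_sub_hull (T : Tri) {X : Pt} (h : X ∈ T.outline) : X ∈ T.hull := by
  rw [Tri.mem_hull]
  rcases h with (⟨s, t, hs, ht, hst, rfl⟩ | ⟨s, t, hs, ht, hst, rfl⟩) | ⟨s, t, hs, ht, hst, rfl⟩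
  · exact ⟨s, t, 0, hs, ht, le_rfl, by linarith, by module⟩
  · exact ⟨0, s, t, le_rfl, hs, ht, by linarith, by module⟩
  · exact ⟨t, 0, s, ht, le_rfl, hs, by linarith, by module⟩

/-- every outline point lies on a nontrivial segment in the outline -/
theorem Tri.exists_edge (T : Tri) {P : Pt} (h : P ∈ T.outline) :
    ∃ D, D ≠ P ∧ segment ℝ P D ⊆ T.outline := by
  have key : ∀ A B : Pt, A ≠ B → segment ℝ A B ⊆ T.outline → P ∈ segment ℝ A B →
      ∃ D, D ≠ P ∧ segment ℝ P D ⊆ T.outline := by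
    intro A B hAB hs hP
    by_cases hA : A = P
    · exact ⟨B, by rw [← hA]; exact hAB.symm, by rw [← hA]; exact hs⟩
    · exact ⟨A, hA, ((convex_segment A B).segment_subset hP (left_mem_segment _ _ _)).trans hs⟩
  have inj := T.indep.injective
  have h01 : T.A ≠ T.B := fun h => by simpa using inj.ne (show (0 : Fin 3) ≠ 1 by decide) h
  have h12 : T.B ≠ T.C := fun h => by simpa using inj.ne (show (1 : Fin 3) ≠ 2 by decide) h
  have h20 : T.C ≠ T.A := fun h => by simpa using inj.ne (show (2 : Fin 3) ≠ 0 by decide) h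
  rcases h with (h | h) | h
  · exact key _ _ h01 (fun x hx => Or.inl (Or.inl hx)) h
  · exact key _ _ h12 (fun x hx => Or.inl (Or.inr hx)) h
  · exact key _ _ h20 (fun x hx => Or.inr hx) h

theorem Tri.extreme (T : Tri) {P X Y : Pt} (h : P ∈ T.outline) (hX : X ∈ T.hull) (hY : Y ∈ T.hull)
    (hP : P ∈ openSegment ℝ X Y) : X ∈ T.outline ∧ segment ℝ P X ⊆ T.outline := by
  obtain ⟨s, t, hs, ht, hst, hPe⟩ := hP
  obtain ⟨a, b, c, ha, hb, hc, habc, hXe⟩ := Tri.mem_hull.1 hX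
  obtain ⟨a', b', c', ha', hb', hc', habc', hYe⟩ := Tri.mem_hull.1 hY
  have z : ∀ u v : ℝ, 0 ≤ u → 0 ≤ v → s * u + t * v = 0 → u = 0 := by
    intro u v hu hv h
    nlinarith [mul_nonneg ht.le hv, mul_nonneg hs.le hu, mul_eq_zero.1 (show s * u = 0 by nlinarith [mul_nonneg ht.le hv, mul_nonneg hs.le hu]) |>.resolve_left hs.ne']
  have key : ∀ A B : Pt, segment ℝ A B ⊆ T.outline → P ∈ segment ℝ A B → X ∈ segment ℝ A B →
      X ∈ T.outline ∧ segment ℝ P X ⊆ T.outline := fun A B h1 h2 h3 =>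
    ⟨h1 h3, ((convex_segment A B).segment_subset h2 h3).trans h1⟩
  have hsum : s * (a + b + c) + t * (a' + b' + c') = 1 := by rw [habc, habc']; linarith
  rcases h with (h | h) | h
  · refine key _ _ (fun x hx => Or.inl (Or.inl hx)) h ?_
    obtain ⟨u, v, hu, hv, huv, e⟩ := h
    have := T.uniq (a := s * a + t * a' - u) (b := s * b + t * b' - v) (c := s * c + t * c')
      (by linarith) (by
        have e2 := e.trans hPe.symm
        rw [hXe, hYe] at e2
        rw [← sub_eq_zero] at e2
        rw [← neg_eq_zero, ← e2]; module)
    have := z c c' hc hc' this.2.2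
    subst this
    exact ⟨a, b, ha, hb, by linarith, by rw [hXe]; module⟩
  · refine key _ _ (fun x hx => Or.inl (Or.inr hx)) h ?_
    obtain ⟨u, v, hu, hv, huv, e⟩ := h
    have := T.uniq (a := s * a + t * a') (b := s * b + t * b' - u) (c := s * c + t * c' - v)
      (by linarith) (by
        have e2 := e.trans hPe.symm
        rw [hXe, hYe] at e2
        rw [← sub_eq_zero] at e2
        rw [← neg_eq_zero, ← e2]; module)
    have := z a a' ha ha' this.1
    subst this
    exact ⟨b, c, hb, hc, by linarith, by rw [hXe]; module⟩
  · refine key _ _ (fun x hx => Or.inr hx) h ?_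
    obtain ⟨u, v, hu, hv, huv, e⟩ := h
    have := T.uniq (a := s * a + t * a' - v) (b := s * b + t * b') (c := s * c + t * c' - u)
      (by linarith) (by
        have e2 := e.trans hPe.symm
        rw [hXe, hYe] at e2
        rw [← sub_eq_zero] at e2
        rw [← neg_eq_zero, ← e2]; module)
    have := z b b' hb hb' this.2.1
    subst this
    exact ⟨c, a, hc, ha, by linarith, by rw [hXe]; module⟩

theorem eps_exists (a a' : ℝ) (ha : 0 < a) :
    ∃ e, 0 < e ∧ ∀ t, 0 ≤ t → t ≤ e → 0 ≤ (1 - t) * a + t * a' := by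
  refine ⟨a / (a + |a'|), by positivity, ?_⟩
  intro t ht h
  rw [le_div_iff₀ (by positivity)] at h
  nlinarith [neg_abs_le a', mul_le_mul_of_nonneg_left (neg_abs_le a') ht]

theorem no_edge {S T : Tri} (hd : Disjoint S.outline T.outline) {P Q : Pt}
    (h : S.outline ∩ T.hull = {P, Q}) {P' D : Pt} (hP : P' ∈ S.outline ∩ T.hull)
    (hDP : D ≠ P') (hD : D ∈ T.plane) (hs : segment ℝ P' D ⊆ S.outline) : False := by
  obtain ⟨a, b, c, ha, hb, hc, habc, hPe⟩ := Tri.mem_hull.1 hP.2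
  obtain ⟨a', b', c', habc', hDe⟩ := Tri.mem_plane hD
  have hn : P' ∉ T.outline := fun h => Set.disjoint_left.1 hd hP.1 h
  have ha : 0 < a := by
    refine lt_of_le_of_ne ha (fun h0 => hn (Or.inl (Or.inr ⟨b, c, hb, hc, by linarith, ?_⟩)))
    rw [hPe, ← h0]; module
  have hb : 0 < b := by
    refine lt_of_le_of_ne hb (fun h0 => hn (Or.inr ⟨c, a, hc, ha.le, by linarith, ?_⟩))
    rw [hPe, ← h0]; module
  have hc : 0 < c := by
    refine lt_of_le_of_ne hc (fun h0 => hn (Or.inl (Or.inl ⟨a, b, ha.le, hb.le, by linarith, ?_⟩)))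
    rw [hPe, ← h0]; module
  obtain ⟨e1, he1, k1⟩ := eps_exists a a' ha
  obtain ⟨e2, he2, k2⟩ := eps_exists b b' hb
  obtain ⟨e3, he3, k3⟩ := eps_exists c c' hc
  obtain ⟨e, he, l1, l2, l3, l4⟩ : ∃ e : ℝ, 0 < e ∧ e ≤ e1 ∧ e ≤ e2 ∧ e ≤ e3 ∧ e ≤ 1 :=
    ⟨min (min e1 e2) (min e3 1), by positivity, by simp, by simp, by simp, by simp⟩
  have mem : ∀ t, 0 ≤ t → t ≤ e → (1 - t) • P' + t • D ∈ ({P, Q} : Set Pt) := by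
    intro t ht hte
    rw [← h]
    refine ⟨hs ⟨1 - t, t, by linarith, ht, by ring, rfl⟩, Tri.mem_hull.2 ⟨_, _, _,
      k1 t ht (by linarith), k2 t ht (by linarith), k3 t ht (by linarith), ?_, ?_⟩⟩
    · linear_combination (1 - t) * habc + t * habc'
    · rw [hPe, hDe]; module
  have inj : ∀ t u : ℝ, (1 - t) • P' + t • D = (1 - u) • P' + u • D → t = u := by
    intro t u htu
    have : (t - u) • (D - P') = 0 := by
      rw [← sub_eq_zero] at htu
      rw [← htu]; module
    rcases smul_eq_zero.1 this with h | h
    · linarith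
    · exact absurd (sub_eq_zero.1 h) hDP
  have m0 := mem 0 le_rfl he.le
  have m1 := mem (e / 2) (by linarith) (by linarith)
  have m2 := mem e he.le le_rfl
  simp only [Set.mem_insert_iff, Set.mem_singleton_iff] at m0 m1 m2
  have n01 := inj 0 (e / 2)
  have n02 := inj 0 e
  have n12 := inj (e / 2) e
  have q1 : (0 : ℝ) ≠ e / 2 := by linarith
  have q2 : (0 : ℝ) ≠ e := by linarith
  have q3 : (e / 2 : ℝ) ≠ e := by linarith
  rcases m0 with m0 | m0 <;> rcases m1 with m1 | m1 <;> rcases m2 with m2 | m2 <;>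
    first
    | exact q1 (n01 (m0.trans m1.symm))
    | exact q2 (n02 (m0.trans m2.symm))
    | exact q3 (n12 (m1.trans m2.symm))

theorem cross_sub {S T : Tri} (hd : Disjoint S.outline T.outline) {P Q : Pt} (hPQ : P ≠ Q)
    (h : S.outline ∩ T.hull = {P, Q}) {X : Pt} (hX : X ∈ S.hull) (hXT : X ∈ T.plane) :
    Wbtw ℝ P X Q := by
  have hP : P ∈ S.outline ∩ T.hull := by rw [h]; simp
  have hQ : Q ∈ S.outline ∩ T.hull := by rw [h]; simp
  have hPT := T.hull_sub_plane hP.2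
  have hQT := T.hull_sub_plane hQ.2
  have side : ∀ P' Q' : Pt, P' ≠ Q' → P' ∈ S.outline ∩ T.hull → Q' ∈ S.outline ∩ T.hull →
      Wbtw ℝ P' Q' X → X = Q' := by
    intro P' Q' hne hP' hQ' hw
    by_contra hXQ
    have hos : Q' ∈ openSegment ℝ P' X :=
      mem_openSegment_of_ne_left_right hne hXQ (mem_segment_iff_wbtw.2 hw)
    exact no_edge hd h hQ' hne (T.hull_sub_plane hP'.2)
      (S.extreme hQ'.1 (S.outline_sub_hull hP'.1) hX hos).2
  have hcol : Collinear ℝ {P, X, Q} := by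
    by_contra hnc
    rw [← affineIndependent_iff_not_collinear_set] at hnc
    have hr : ∀ A B C : Pt, Set.range ![A, B, C] = ({A, B, C} : Set Pt) := by
      intro A B C
      simp only [Matrix.range_cons, Matrix.range_empty, Set.union_empty, Set.singleton_union]
    have hle : affineSpan ℝ (Set.range ![P, X, Q]) ≤ S.plane := by
      rw [affineSpan_le, hr]
      rintro Y (rfl | rfl | rfl)
      · exact S.hull_sub_plane (S.outline_sub_hull hP.1)
      · exact S.hull_sub_plane hX
      · exact S.hull_sub_plane (S.outline_sub_hull hQ.1)
    have hleT : affineSpan ℝ (Set.range ![P, X, Q]) ≤ T.plane := by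
      rw [affineSpan_le, hr]
      rintro Y (rfl | rfl | rfl)
      · exact hPT
      · exact hXT
      · exact hQT
    have hfr : Module.finrank ℝ S.plane.direction = 2 := by
      rw [direction_affineSpan, ← hr]
      exact S.indep.finrank_vectorSpan (by simp)
    have heq : affineSpan ℝ (Set.range ![P, X, Q]) = S.plane := by
      refine hnc.affineSpan_eq_of_le_of_card_eq_finrank_add_one hle ?_
      rw [hfr]; simp
    obtain ⟨D, hD, hs⟩ := S.exists_edge hP.1
    refine no_edge hd h hP hD ?_ hs
    apply hleT
    rw [heq]
    exact S.hull_sub_plane (S.outline_sub_hull (hs (right_mem_segment _ _ _)))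
  rcases hcol.wbtw_or_wbtw_or_wbtw with hw | hw | hw
  · exact hw
  · rw [side P Q hPQ hP hQ hw.symm]
    exact wbtw_self_right ℝ P Q
  · rw [side Q P hPQ.symm hQ hP hw]
    exact wbtw_self_left ℝ P Q

theorem ext_plane {s : AffineSubspace ℝ Pt} {P Q T U : Pt} (hPQ : P ≠ Q) (hP : P ∈ s) (hQ : Q ∈ s)
    (h1 : Wbtw ℝ T P U) (h2 : Wbtw ℝ T Q U) : T ∈ s ∧ U ∈ s := by
  obtain ⟨p, -, rfl⟩ := h1
  obtain ⟨q, -, rfl⟩ := h2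
  have hpq : p ≠ q := fun h => hPQ (by rw [h])
  have hpq' : q - p ≠ 0 := sub_ne_zero.2 hpq.symm
  have g : ∀ r : ℝ, AffineMap.lineMap T U r ∈ s := by
    intro r
    have := AffineMap.lineMap_mem ((r - p) / (q - p)) hP hQ
    have e : r = p + (r - p) / (q - p) * (q - p) := by field_simp; ring
    convert this using 1
    generalize (r - p) / (q - p) = k at e
    subst e
    simp only [AffineMap.lineMap_apply_module]
    module
  exact ⟨by simpa using g 0, by simpa using g 1⟩

theorem stmt15 (Δ0 Δ1 Δ2 : Tri)
    (h01 : Disjoint Δ0.outline Δ1.outline)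
    (h12 : Disjoint Δ1.outline Δ2.outline)
    (h20 : Disjoint Δ2.outline Δ0.outline)
    (hcap : (Δ0.hull ∩ Δ1.hull ∩ Δ2.hull).Nonempty)
    (t0 : ∃ P Q : Pt, P ≠ Q ∧ Δ0.outline ∩ Δ1.hull = {P, Q})
    (t1 : ∃ P Q : Pt, P ≠ Q ∧ Δ1.outline ∩ Δ2.hull = {P, Q})
    (t2 : ∃ P Q : Pt, P ≠ Q ∧ Δ2.outline ∩ Δ0.hull = {P, Q})
    (P Q : Pt) (hPQ : P ≠ Q) (hpq : Δ1.outline ∩ Δ2.hull = {P, Q}) :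
    (affineSpan ℝ ({Δ0.A, Δ0.B, Δ0.C} : Set Pt)).SOppSide P Q := by
  obtain ⟨X, ⟨hX0, hX1⟩, hX2⟩ := hcap
  obtain ⟨R, S, hRS, hrs⟩ := t0
  obtain ⟨T, U, hTU, htu⟩ := t2
  have hP : P ∈ Δ1.outline ∩ Δ2.hull := by rw [hpq]; simp
  have hQ : Q ∈ Δ1.outline ∩ Δ2.hull := by rw [hpq]; simp
  have hR : R ∈ Δ0.outline ∩ Δ1.hull := by rw [hrs]; simp
  have hS : S ∈ Δ0.outline ∩ Δ1.hull := by rw [hrs]; simp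
  have hT : T ∈ Δ2.outline ∩ Δ0.hull := by rw [htu]; simp
  have hU : U ∈ Δ2.outline ∩ Δ0.hull := by rw [htu]; simp
  -- X is not on the outline of the second triangle
  have hXn : X ∉ Δ1.outline := by
    intro hXo
    have hw := cross_sub h01 hRS hrs hX0 (Δ1.hull_sub_plane hX1)
    by_cases hXR : R = X
    · exact Set.disjoint_left.1 h01 hR.1 (hXR ▸ hXo)
    by_cases hXS : S = X
    · exact Set.disjoint_left.1 h01 hS.1 (hXS ▸ hXo)
    exact Set.disjoint_left.1 h01 hR.1 (Δ1.extreme hXo hR.2 hS.2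
      (mem_openSegment_of_ne_left_right hXR hXS (mem_segment_iff_wbtw.2 hw))).1
  have hw := cross_sub h12 hPQ hpq hX1 (Δ2.hull_sub_plane hX2)
  have hXP : P ≠ X := fun h => hXn (h ▸ hP.1)
  have hXQ : Q ≠ X := fun h => hXn (h ▸ hQ.1)
  have hXp0 := Δ0.hull_sub_plane hX0
  have hnot : ¬ (P ∈ Δ0.plane ∧ Q ∈ Δ0.plane) := by
    rintro ⟨hP0, hQ0⟩
    have a1 := cross_sub h20 hTU htu hP.2 hP0
    have a2 := cross_sub h20 hTU htu hQ.2 hQ0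
    obtain ⟨hT1, hU1⟩ := ext_plane hPQ (Δ1.hull_sub_plane (Δ1.outline_sub_hull hP.1))
      (Δ1.hull_sub_plane (Δ1.outline_sub_hull hQ.1)) a1 a2
    have b1 := cross_sub h01 hRS hrs hT.2 hT1
    have b2 := cross_sub h01 hRS hrs hU.2 hU1
    obtain ⟨hR2, hS2⟩ := ext_plane hTU (Δ2.hull_sub_plane (Δ2.outline_sub_hull hT.1))
      (Δ2.hull_sub_plane (Δ2.outline_sub_hull hU.1)) b1 b2
    have c1 := cross_sub h12 hPQ hpq hR.2 hR2
    have c2 := cross_sub h12 hPQ hpq hS.2 hS2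
    rw [← mem_segment_iff_wbtw] at a1 b1 b2 c1 c2
    have hPRS : P ∈ segment ℝ R S := (convex_segment R S).segment_subset b1 b2 a1
    by_cases hRP : R = P
    · exact Set.disjoint_left.1 h01 hR.1 (hRP ▸ hP.1)
    by_cases hSP : S = P
    · exact Set.disjoint_left.1 h01 hS.1 (hSP ▸ hP.1)
    exact Set.disjoint_left.1 h01 hR.1 (Δ1.extreme hP.1 hR.2 hS.2
      (mem_openSegment_of_ne_left_right hRP hSP hPRS)).1
  refine ⟨hw.wOppSide₁₃ hXp0, fun h => ?_, fun h => ?_⟩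
  · refine hnot ⟨h, (ext_plane (s := Δ0.plane) hXP h hXp0 (wbtw_self_left ℝ P Q) hw).2⟩
  · refine hnot ⟨(ext_plane (s := Δ0.plane) hXQ h hXp0 (wbtw_self_right ℝ P Q) hw).1, h⟩
end
end
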